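/- arXiv:1909.02350 — 10 statements merged into one kernel-verified Lean document; each statement's English description precedes it below -/
import Mathlib

section
/- Let n ≥ 2 be an integer and K > 0. If w : [0,∞) → ℝ is continuous with w(0) = 1, twice continuously differentiable on (0,∞), and satisfies t(t+1)·w''(t) + (2t + n/2)·w'(t) + ((1 − (n−1)² − 4√K)/4)·w(t) = 0 for all t > 0, then w(t) > 0 for every t ≥ 0. -/
open Real Set

/-- If `w` is positive on `(0,T)`, then the derivative is nonnegative there. -/
theorem clamped_aux (a c : ℝ) (ha : 1 ≤ a) (hc : c ≤ 0) (w : ℝ → ℝ)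
    (hcont : ContinuousOn w (Set.Ici 0))
    (hd1 : ∀ t : ℝ, 0 < t → HasDerivAt w (deriv w t) t)
    (hd2 : ∀ t : ℝ, 0 < t → HasDerivAt (deriv w) (deriv (deriv w) t) t)
    (hODE : ∀ t : ℝ, 0 < t →
      t * (t + 1) * deriv (deriv w) t + (2 * t + a) * deriv w t + c * w t = 0)
    (T : ℝ) (hpos : ∀ t : ℝ, 0 < t → t < T → 0 < w t) :
    ∀ s : ℝ, 0 < s → s < T → 0 ≤ deriv w s := by
  intro s hs hsT
  by_contra! hneg
  set r : ℝ → ℝ := fun t => Real.exp ((a - 1) * (Real.log t - Real.log (t + 1))) with hr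
  set P : ℝ → ℝ := fun t => r t * (t * (t + 1) * deriv w t) with hP
  have hrpos : ∀ t, 0 < r t := fun t => Real.exp_pos _
  have hPd : ∀ t : ℝ, 0 < t → HasDerivAt P (r t * (-c * w t)) t := by
    intro t ht
    have h1 : HasDerivAt r (r t * ((a - 1) * (t⁻¹ - (t + 1)⁻¹))) t := by
      have hl : HasDerivAt (fun t : ℝ => Real.log (t + 1)) ((t + 1)⁻¹) t := by
        have := ((hasDerivAt_id t).add_const (1 : ℝ)).log (by simp; linarith)
        simpa using this
      exact (((Real.hasDerivAt_log ht.ne').sub hl).const_mul (a - 1)).exp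
    have h2 : HasDerivAt (fun t : ℝ => t * (t + 1)) (1 * (t + 1) + t * 1) t :=
      (hasDerivAt_id t).mul ((hasDerivAt_id t).add_const (1 : ℝ))
    have h3 := h1.mul (h2.mul (hd2 t ht))
    refine h3.congr_deriv ?_
    have ho := hODE t ht
    have ht1 : t + 1 ≠ 0 := by linarith
    have e : t⁻¹ - (t + 1)⁻¹ = 1 / (t * (t + 1)) := by field_simp; ring
    have e2 : (t⁻¹ - (t + 1)⁻¹) * (t * (t + 1)) = 1 := by
      rw [e]; field_simp
    simp only [Pi.mul_apply]
    linear_combination r t * ho + r t * (a - 1) * deriv w t * e2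
  have hPmono : MonotoneOn P (Ioc 0 s) := by
    apply monotoneOn_of_deriv_nonneg (convex_Ioc 0 s)
    · intro t ht
      exact (hPd t ht.1).continuousAt.continuousWithinAt
    · intro t ht
      rw [interior_Ioc] at ht
      exact (hPd t ht.1).differentiableAt.differentiableWithinAt
    · intro t ht
      rw [interior_Ioc] at ht
      rw [(hPd t ht.1).deriv]
      have := hpos t ht.1 (ht.2.trans hsT)
      have := hrpos t
      have : 0 ≤ -c := by linarith
      positivity
  have hrmono : ∀ t, 0 < t → t ≤ s → r t ≤ r s := by
    intro t ht hts
    apply Real.exp_le_exp.2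
    apply mul_le_mul_of_nonneg_left _ (by linarith)
    rw [← Real.log_div ht.ne' (by linarith), ← Real.log_div hs.ne' (by linarith)]
    apply Real.log_le_log (by positivity)
    rw [div_le_div_iff₀ (by linarith) (by linarith)]
    nlinarith
  have hQ : ∀ t, 0 < t → t ≤ s → t * (t + 1) * deriv w t ≤ s * (s + 1) * deriv w s := by
    intro t ht hts
    have h1 : P t ≤ P s := hPmono ⟨ht, hts⟩ ⟨hs, le_rfl⟩ hts
    have h2 := hrmono t ht hts
    have h3 : s * (s + 1) * deriv w s < 0 := mul_neg_of_pos_of_neg (by positivity) hneg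
    have h4 : r t * (t * (t + 1) * deriv w t) ≤ r t * (s * (s + 1) * deriv w s) := by
      refine h1.trans ?_
      exact mul_le_mul_of_nonpos_right h2 h3.le
    exact le_of_mul_le_mul_left h4 (hrpos t)
  set δ : ℝ := - (s * deriv w s) with hδ
  have hδpos : 0 < δ := by
    have := mul_neg_of_pos_of_neg hs hneg
    linarith
  have hanti : AntitoneOn (fun t => w t + δ * Real.log t) (Ioc 0 s) := by
    have hd : ∀ t : ℝ, 0 < t →
        HasDerivAt (fun t => w t + δ * Real.log t) (deriv w t + δ * t⁻¹) t := fun t ht =>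
      (hd1 t ht).add ((Real.hasDerivAt_log ht.ne').const_mul δ)
    apply antitoneOn_of_deriv_nonpos (convex_Ioc 0 s)
    · intro t ht
      exact (hd t ht.1).continuousAt.continuousWithinAt
    · intro t ht
      rw [interior_Ioc] at ht
      exact (hd t ht.1).differentiableAt.differentiableWithinAt
    · intro t ht
      rw [interior_Ioc] at ht
      rw [(hd t ht.1).deriv]
      have h1 := hQ t ht.1 ht.2.le
      have ht0 := ht.1
      have h2 : (t + 1) * (t * deriv w t) ≤ (t + 1) * (-δ) := by
        have : δ * t ≤ δ * s := mul_le_mul_of_nonneg_left ht.2.le hδpos.le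
        have e : s * (s + 1) * deriv w s = -δ * (s + 1) := by rw [hδ]; ring
        nlinarith
      have h3 : t * deriv w t ≤ -δ := le_of_mul_le_mul_left h2 (by linarith)
      have h4 : t * (deriv w t + δ * t⁻¹) ≤ t * 0 := by
        have : t * t⁻¹ = 1 := mul_inv_cancel₀ ht0.ne'
        nlinarith
      exact le_of_mul_le_mul_left h4 ht0
  obtain ⟨B, hB⟩ := (isCompact_Icc (a := (0 : ℝ)) (b := s)).bddAbove_image
    (hcont.mono Icc_subset_Ici_self)
  have hB' : ∀ t, 0 ≤ t → t ≤ s → w t ≤ B := fun t h1 h2 => hB ⟨t, ⟨h1, h2⟩, rfl⟩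
  have hws := hpos s hs hsT
  have hB0 : 0 < B := hws.trans_le (hB' s hs.le le_rfl)
  set t : ℝ := s * Real.exp (-(B / δ)) with ht
  have htpos : 0 < t := by positivity
  have hts : t ≤ s := by
    have : Real.exp (-(B / δ)) ≤ 1 := Real.exp_le_one_iff.2 (by
      have : 0 < B / δ := by positivity
      linarith)
    nlinarith
  have h1 := hanti ⟨htpos, hts⟩ ⟨hs, le_rfl⟩ hts
  have h2 : Real.log t = Real.log s - B / δ := by
    rw [ht, Real.log_mul hs.ne' (Real.exp_ne_zero _), Real.log_exp]; ring
  have h3 : δ * (B / δ) = B := by field_simp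
  have h4 := hB' t htpos.le hts
  simp only [h2] at h1
  nlinarith

theorem clamped_plate_stmt0
    (n : ℕ) (hn : 2 ≤ n) (K : ℝ) (hK : 0 < K) (w : ℝ → ℝ)
    (hcont : ContinuousOn w (Set.Ici 0))
    (hw0 : w 0 = 1)
    (hsmooth : ContDiffOn ℝ 2 w (Set.Ioi 0))
    (hODE : ∀ t : ℝ, 0 < t →
      t * (t + 1) * deriv (deriv w) t + (2 * t + (n : ℝ) / 2) * deriv w t
        + ((1 - ((n : ℝ) - 1) ^ 2 - 4 * Real.sqrt K) / 4) * w t = 0) :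
    ∀ t : ℝ, 0 ≤ t → 0 < w t := by
  have hn' : (2 : ℝ) ≤ n := by exact_mod_cast hn
  have hd1 : ∀ t : ℝ, 0 < t → HasDerivAt w (deriv w t) t := fun t ht =>
    ((hsmooth.differentiableOn (by norm_num)).differentiableAt (Ioi_mem_nhds ht)).hasDerivAt
  have hs1 : ContDiffOn ℝ 1 (deriv w) (Set.Ioi 0) :=
    hsmooth.deriv_of_isOpen isOpen_Ioi (by norm_num)
  have hd2 : ∀ t : ℝ, 0 < t → HasDerivAt (deriv w) (deriv (deriv w) t) t := fun t ht =>
    ((hs1.differentiableOn (by norm_num)).differentiableAt (Ioi_mem_nhds ht)).hasDerivAt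
  intro t1 ht1
  by_contra! hw1
  have hcl : IsCompact (Icc 0 t1 ∩ w ⁻¹' Iic 0) :=
    isCompact_Icc.of_isClosed_subset
      ((hcont.mono Icc_subset_Ici_self).preimage_isClosed_of_isClosed isClosed_Icc isClosed_Iic)
      inter_subset_left
  obtain ⟨t0, ⟨⟨h00, h01⟩, hwt0⟩, hleast⟩ := hcl.exists_isLeast ⟨t1, ⟨ht1, le_rfl⟩, hw1⟩
  have hwt0' : w t0 ≤ 0 := hwt0
  have hpos : ∀ t : ℝ, 0 < t → t < t0 → 0 < w t := by
    intro t h1 h2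
    by_contra! h3
    exact absurd (hleast ⟨⟨h1.le, by linarith⟩, h3⟩) (not_le.2 h2)
  have hder := clamped_aux _ _ (by linarith) (by
    have := Real.sqrt_nonneg K
    nlinarith) w hcont hd1 hd2 hODE t0 hpos
  have hmono : MonotoneOn w (Icc 0 t0) := by
    apply monotoneOn_of_deriv_nonneg (convex_Icc 0 t0) (hcont.mono Icc_subset_Ici_self)
    · intro t ht
      rw [interior_Icc] at ht
      exact (hd1 t ht.1).differentiableAt.differentiableWithinAt
    · intro t ht
      rw [interior_Icc] at ht
      exact hder t ht.1 ht.2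
  have := hmono ⟨le_rfl, h00⟩ ⟨h00, le_rfl⟩ h00
  linarith
end

section
/- Let n ≥ 2 be an integer and 0 < K ≤ (n−1)⁴/16. Let w₊, w₋ : [0,∞) → ℝ be continuous with w₊(0) = w₋(0) = 1, twice continuously differentiable on (0,∞), satisfying on (0,∞) the equations t(t+1)·w₊''(t) + (2t + n/2)·w₊'(t) + ((1 − (n−1)² − 4√K)/4)·w₊(t) = 0 and t(t+1)·w₋''(t) + (2t + n/2)·w₋'(t) + ((1 − (n−1)² + 4√K)/4)·w₋(t) = 0. Then w₊(t) ≥ w₋(t) > 0 for every t ≥ 0. -/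
open Real Set

/-- The Sturm–Liouville weight. -/
noncomputable def slw (m t : ℝ) : ℝ := Real.exp (m * Real.log t + (2 - m) * Real.log (t + 1))

lemma slw_hasDeriv (m t : ℝ) (ht : 0 < t) :
    HasDerivAt (slw m) (slw m t * ((2 * t + m) / (t * (t + 1)))) t := by
  have h1 : HasDerivAt (fun s : ℝ => m * Real.log s) (m * t⁻¹) t :=
    (Real.hasDerivAt_log ht.ne').const_mul m
  have h2 : HasDerivAt (fun s : ℝ => (2 - m) * Real.log (s + 1)) ((2 - m) * (1 / (t + 1))) t :=
    (((hasDerivAt_id t).add_const 1).log (by simp; linarith)).const_mul (2 - m)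
  have h3 := (h1.add h2).exp
  have e : (m * t⁻¹ + (2 - m) * (1 / (t + 1))) = (2 * t + m) / (t * (t + 1)) := by
    have : t + 1 ≠ 0 := by linarith
    field_simp
    ring
  rw [e] at h3
  exact h3

lemma slw_le (m t : ℝ) (hm : 1 ≤ m) (ht : 0 < t) (ht1 : t ≤ 1) :
    slw m t ≤ Real.exp 2 * t := by
  have hl : Real.log t ≤ 0 := Real.log_nonpos ht.le ht1
  have h0 : 0 ≤ Real.log (t + 1) := Real.log_nonneg (by linarith)
  have h1 : Real.log (t + 1) ≤ 1 := by
    have := Real.log_le_sub_one_of_pos (show 0 < t + 1 by linarith)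
    linarith
  have : m * Real.log t + (2 - m) * Real.log (t + 1) ≤ 2 + Real.log t := by nlinarith
  calc slw m t ≤ Real.exp (2 + Real.log t) := Real.exp_le_exp.2 this
    _ = _ := by rw [Real.exp_add, Real.exp_log ht]

/-- A continuous function on `[0,T)` cannot have derivative at most `-k/t` near `0`. -/
lemma no_log (r r1 : ℝ → ℝ) (s k B : ℝ) (hs : 0 < s) (hk : 0 < k)
    (hB : ∀ t, 0 < t → t ≤ s → r t ≤ B)
    (hd : ∀ t, 0 < t → t ≤ s → HasDerivAt r (r1 t) t)
    (hle : ∀ t, 0 < t → t ≤ s → r1 t ≤ -(k / t)) : False := by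
  have hg : ∀ t, 0 < t → t ≤ s →
      HasDerivAt (fun x => r x + k * Real.log x) (r1 t + k * t⁻¹) t := fun t h0 h1 =>
    (hd t h0 h1).add ((Real.hasDerivAt_log h0.ne').const_mul k)
  have anti : AntitoneOn (fun x => r x + k * Real.log x) (Ioc 0 s) := by
    apply antitoneOn_of_deriv_nonpos (convex_Ioc 0 s)
    · intro t ht
      exact (hg t ht.1 ht.2).continuousAt.continuousWithinAt
    · intro t ht
      have ht := interior_subset ht
      exact (hg t ht.1 ht.2).differentiableAt.differentiableWithinAt
    · intro t ht
      have ht := interior_subset ht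
      rw [(hg t ht.1 ht.2).deriv]
      have := hle t ht.1 ht.2
      rw [div_eq_mul_inv] at this
      linarith
  set g := r s + k * Real.log s with hgdef
  set q := min s (Real.exp (-(B - g + 1) / k)) with hq
  have hq0 : 0 < q := lt_min hs (Real.exp_pos _)
  have hqs : q ≤ s := min_le_left _ _
  have h1 : g ≤ r q + k * Real.log q := anti ⟨hq0, hqs⟩ ⟨hs, le_rfl⟩ hqs
  have h2 := hB q hq0 hqs
  have h3 : Real.log q ≤ -(B - g + 1) / k := by
    have := Real.log_le_log hq0 (min_le_right s (Real.exp (-(B - g + 1) / k)))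
    rwa [Real.log_exp] at this
  have h4 : k * Real.log q ≤ -(B - g + 1) := by
    rw [le_div_iff₀ hk] at h3
    linarith
  linarith

lemma cmp_pos (m a b T : ℝ) (hm : 1 ≤ m) (hab : a ≤ b) (hT : 0 < T)
    (u u1 u2 v v1 v2 : ℝ → ℝ)
    (cu : ContinuousOn u (Ici 0)) (cv : ContinuousOn v (Ici 0))
    (hu0 : u 0 = 1) (hv0 : v 0 = 1)
    (du : ∀ t, 0 < t → HasDerivAt u (u1 t) t) (du1 : ∀ t, 0 < t → HasDerivAt u1 (u2 t) t)
    (dv : ∀ t, 0 < t → HasDerivAt v (v1 t) t) (dv1 : ∀ t, 0 < t → HasDerivAt v1 (v2 t) t)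
    (eu : ∀ t, 0 < t → t * (t + 1) * u2 t + (2 * t + m) * u1 t + a * u t = 0)
    (ev : ∀ t, 0 < t → t * (t + 1) * v2 t + (2 * t + m) * v1 t + b * v t ≤ 0)
    (vpos : ∀ t, 0 ≤ t → 0 < v t)
    (upos : ∀ t, 0 ≤ t → t < T → 0 < u t) : v T ≤ u T := by
  set W : ℝ → ℝ := fun t => slw m t * (u1 t * v t - u t * v1 t) with hW
  have pp : ∀ t, 0 < slw m t := fun t => Real.exp_pos _
  have dW : ∀ t, 0 < t → HasDerivAt W (slw m t * ((2 * t + m) / (t * (t + 1))) *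
      (u1 t * v t - u t * v1 t) + slw m t * ((u2 t * v t + u1 t * v1 t) -
        (u1 t * v1 t + u t * v2 t))) t := fun t ht =>
    (slw_hasDeriv m t ht).mul (((du1 t ht).mul (dv t ht)).sub ((du t ht).mul (dv1 t ht)))
  have monoW : MonotoneOn W (Ioo 0 T) := by
    apply monotoneOn_of_deriv_nonneg (convex_Ioo 0 T)
    · intro t ht
      exact (dW t ht.1).continuousAt.continuousWithinAt
    · intro t ht
      have ht := interior_subset ht
      exact (dW t ht.1).differentiableAt.differentiableWithinAt
    · intro t ht
      have ht := interior_subset ht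
      rw [(dW t ht.1).deriv]
      have h0 := ht.1
      have e1 := eu t h0
      have e2 := ev t h0
      have hv := vpos t h0.le
      have hu := upos t h0.le ht.2
      have key : 0 ≤ (2 * t + m) * (u1 t * v t - u t * v1 t)
          + t * (t + 1) * (u2 t * v t - u t * v2 t) := by
        have h1 := mul_nonneg hu.le (neg_nonneg.2 e2)
        have h2 := mul_nonneg (sub_nonneg.2 hab) (mul_pos hu hv).le
        have h3 : v t * (t * (t + 1) * u2 t + (2 * t + m) * u1 t + a * u t) = 0 := by
          rw [e1, mul_zero]
        linarith
      have hne : t + 1 ≠ 0 := by linarith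
      have : slw m t * ((2 * t + m) / (t * (t + 1))) *
        (u1 t * v t - u t * v1 t) + slw m t * ((u2 t * v t + u1 t * v1 t) -
        (u1 t * v1 t + u t * v2 t)) = slw m t / (t * (t + 1)) *
         ((2 * t + m) * (u1 t * v t - u t * v1 t)
          + t * (t + 1) * (u2 t * v t - u t * v2 t)) := by
        have := h0.ne'
        field_simp
        ring
      rw [this]
      exact mul_nonneg (div_nonneg (pp t).le (by positivity)) key
  set r : ℝ → ℝ := fun t => u t / v t with hr
  have dr : ∀ t, 0 < t → HasDerivAt r ((u1 t * v t - u t * v1 t) / (v t) ^ 2) t := fun t ht =>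
    (du t ht).div (dv t ht) (vpos t ht.le).ne'
  have cr : ContinuousOn r (Ici 0) := cu.div cv (fun t ht => (vpos t ht).ne')
  have Wnn : ∀ t, 0 < t → t < T → 0 ≤ W t := by
    intro t0 h0 h0T
    by_contra! hneg
    set s := min t0 1 with hs
    have hs0 : 0 < s := lt_min h0 one_pos
    have hsub : Icc (0:ℝ) 1 ⊆ Ici 0 := fun x hx => hx.1
    obtain ⟨B, hB⟩ := (isCompact_Icc (a := (0:ℝ)) (b := 1)).bddAbove_image (cr.mono hsub)
    obtain ⟨M, hM⟩ := (isCompact_Icc (a := (0:ℝ)) (b := 1)).bddAbove_image (cv.mono hsub)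
    have hM' : ∀ t, 0 ≤ t → t ≤ 1 → v t ≤ M := fun t h h' => hM ⟨t, ⟨h, h'⟩, rfl⟩
    have M1 : 1 ≤ M := by rw [← hv0]; exact hM' 0 le_rfl zero_le_one
    have hC : 0 < Real.exp 2 * M ^ 2 := by positivity
    refine no_log r _ s (-(W t0) / (Real.exp 2 * M ^ 2)) B hs0 (div_pos (neg_pos.2 hneg) hC)
      (fun t h h' => hB ⟨t, ⟨h.le, h'.trans (min_le_right _ _)⟩, rfl⟩)
      (fun t h _ => dr t h) ?_
    intro t h h'
    have ht0 : t ≤ t0 := h'.trans (min_le_left _ _)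
    have ht1 : t ≤ 1 := h'.trans (min_le_right _ _)
    have hWt : W t ≤ W t0 := monoW ⟨h, ht0.trans_lt h0T⟩ ⟨h0, h0T⟩ ht0
    have hv := vpos t h.le
    have e : (u1 t * v t - u t * v1 t) / (v t) ^ 2 = - ((-W t) / (slw m t * (v t) ^ 2)) := by
      have := (pp t).ne'
      have := hv.ne'
      simp only [hW]
      field_simp
    rw [e, div_div]
    apply neg_le_neg
    have hden : slw m t * (v t) ^ 2 ≤ Real.exp 2 * M ^ 2 * t := by
      calc slw m t * (v t) ^ 2 ≤ (Real.exp 2 * t) * M ^ 2 := by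
            apply mul_le_mul (slw_le m t hm h ht1) _ (by positivity) (by positivity)
            exact pow_le_pow_left₀ hv.le (hM' t h.le ht1) 2
        _ = _ := by ring
    exact div_le_div₀ (by linarith) (by linarith) (mul_pos (pp t) (by positivity)) hden
  have monor : MonotoneOn r (Icc 0 T) := by
    apply monotoneOn_of_deriv_nonneg (convex_Icc 0 T) (cr.mono (fun x hx => hx.1))
    · intro t ht
      rw [interior_Icc] at ht
      exact (dr t ht.1).differentiableAt.differentiableWithinAt
    · intro t ht
      rw [interior_Icc] at ht
      rw [(dr t ht.1).deriv]
      have h := Wnn t ht.1 ht.2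
      exact div_nonneg (nonneg_of_mul_nonneg_right h (pp t)) (by positivity)
  have h := monor ⟨le_rfl, hT.le⟩ ⟨hT.le, le_rfl⟩ hT.le
  simp only [hr, hu0, hv0] at h
  rw [div_one, le_div_iff₀ (vpos T hT.le)] at h
  linarith

lemma cmp_all (m a b : ℝ) (hm : 1 ≤ m) (hab : a ≤ b)
    (u u1 u2 v v1 v2 : ℝ → ℝ)
    (cu : ContinuousOn u (Ici 0)) (cv : ContinuousOn v (Ici 0))
    (hu0 : u 0 = 1) (hv0 : v 0 = 1)
    (du : ∀ t, 0 < t → HasDerivAt u (u1 t) t) (du1 : ∀ t, 0 < t → HasDerivAt u1 (u2 t) t)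
    (dv : ∀ t, 0 < t → HasDerivAt v (v1 t) t) (dv1 : ∀ t, 0 < t → HasDerivAt v1 (v2 t) t)
    (eu : ∀ t, 0 < t → t * (t + 1) * u2 t + (2 * t + m) * u1 t + a * u t = 0)
    (ev : ∀ t, 0 < t → t * (t + 1) * v2 t + (2 * t + m) * v1 t + b * v t ≤ 0)
    (vpos : ∀ t, 0 ≤ t → 0 < v t) : ∀ t, 0 ≤ t → v t ≤ u t := by
  have main := fun T hT => cmp_pos m a b T hm hab hT u u1 u2 v v1 v2 cu cv hu0 hv0 du du1 dv dv1
    eu ev vpos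
  have upos : ∀ t, 0 ≤ t → 0 < u t := by
    by_contra! hcon
    obtain ⟨t1, h1, h1'⟩ := hcon
    set S := Ici (0:ℝ) ∩ u ⁻¹' (Iic 0) with hS
    have hclosed : IsClosed S := cu.preimage_isClosed_of_isClosed isClosed_Ici isClosed_Iic
    have hne : S.Nonempty := ⟨t1, h1, h1'⟩
    have hbd : BddBelow S := ⟨0, fun x hx => hx.1⟩
    have hmem := hclosed.csInf_mem hne hbd
    set T := sInf S
    have hTle : u T ≤ 0 := hmem.2
    have hT0 : (0:ℝ) ≤ T := hmem.1
    have hT : 0 < T := by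
      rcases hT0.lt_or_eq with h | h
      · exact h
      · rw [← h, hu0] at hTle
        linarith
    have := main T hT (fun t h0 hlt => by
      by_contra! hc
      exact absurd (csInf_le hbd (show t ∈ S from ⟨h0, hc⟩)) (not_le.2 hlt))
    have := vpos T hT0
    linarith
  intro t ht
  rcases ht.lt_or_eq with h | h
  · exact main t h (fun s hs _ => upos s hs)
  · rw [← h, hu0, hv0]

lemma smooth_derivs (w : ℝ → ℝ) (h : ContDiffOn ℝ 2 w (Ioi 0)) (t : ℝ) (ht : 0 < t) :
    HasDerivAt w (deriv w t) t ∧ HasDerivAt (deriv w) (deriv (deriv w) t) t := by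
  have hn : Ioi (0:ℝ) ∈ nhds t := Ioi_mem_nhds ht
  constructor
  · exact ((h.differentiableOn (by norm_num)).differentiableAt hn).hasDerivAt
  · have h2 : ContDiffOn ℝ 1 (deriv w) (Ioi 0) := h.deriv_of_isOpen isOpen_Ioi (by norm_num)
    exact ((h2.differentiableOn (by norm_num)).differentiableAt hn).hasDerivAt

lemma rpow_deriv (q t : ℝ) (ht : 0 ≤ t) :
    HasDerivAt (fun s : ℝ => (s + 1) ^ q) (q * (t + 1) ^ (q - 1)) t := by
  have := ((hasDerivAt_id t).add_const 1).rpow_const (p := q)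
    (Or.inl (by simp; linarith))
  simpa using this


theorem clamped_plate_stmt1
    (n : ℕ) (hn : 2 ≤ n) (K : ℝ) (hK : 0 < K) (hK' : K ≤ ((n : ℝ) - 1) ^ 4 / 16)
    (wp wm : ℝ → ℝ)
    (hcont_p : ContinuousOn wp (Set.Ici 0)) (hcont_m : ContinuousOn wm (Set.Ici 0))
    (hp0 : wp 0 = 1) (hm0 : wm 0 = 1)
    (hsmooth_p : ContDiffOn ℝ 2 wp (Set.Ioi 0)) (hsmooth_m : ContDiffOn ℝ 2 wm (Set.Ioi 0))
    (hODEp : ∀ t : ℝ, 0 < t →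
      t * (t + 1) * deriv (deriv wp) t + (2 * t + (n : ℝ) / 2) * deriv wp t
        + ((1 - ((n : ℝ) - 1) ^ 2 - 4 * Real.sqrt K) / 4) * wp t = 0)
    (hODEm : ∀ t : ℝ, 0 < t →
      t * (t + 1) * deriv (deriv wm) t + (2 * t + (n : ℝ) / 2) * deriv wm t
        + ((1 - ((n : ℝ) - 1) ^ 2 + 4 * Real.sqrt K) / 4) * wm t = 0) :
    ∀ t : ℝ, 0 ≤ t → 0 < wm t ∧ wm t ≤ wp t := by

  have hn' : (2:ℝ) ≤ n := by exact_mod_cast hn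
  have hm : 1 ≤ (n:ℝ) / 2 := by linarith
  have hsq : Real.sqrt K ≤ ((n:ℝ) - 1) ^ 2 / 4 := by
    apply Real.sqrt_le_iff.2
    constructor
    · positivity
    · calc K ≤ _ := hK'
        _ = _ := by ring
  have hs0 := Real.sqrt_nonneg K
  have hlow := cmp_all ((n:ℝ) / 2) ((1 - ((n : ℝ) - 1) ^ 2 + 4 * Real.sqrt K) / 4) (1 / 4) hm
    (by linarith) wm (deriv wm) (deriv (deriv wm))
    (fun t => (t + 1) ^ (-(1/2) : ℝ)) (fun t => (-(1/2) : ℝ) * (t + 1) ^ (-(1/2) - 1 : ℝ))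
    (fun t => (-(1/2) : ℝ) * ((-(1/2) - 1) * (t + 1) ^ (-(1/2) - 1 - 1 : ℝ)))
    hcont_m (fun t ht => (rpow_deriv _ t ht).continuousAt.continuousWithinAt)
    hm0 (by norm_num) (fun t ht => (smooth_derivs wm hsmooth_m t ht).1)
    (fun t ht => (smooth_derivs wm hsmooth_m t ht).2)
    (fun t ht => rpow_deriv _ t ht.le)
    (fun t ht => (rpow_deriv _ t ht.le).const_mul _)
    hODEm
    (fun t ht => by
      have hp : 0 < t + 1 := by linarith
      have e1 : (t + 1) ^ (-(1/2) : ℝ) = (t + 1) ^ (-(1/2) - 1 - 1 : ℝ) * (t + 1) ^ 2 := by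
        rw [← Real.rpow_natCast, ← Real.rpow_add hp]
        norm_num
      have e2 : (t + 1) ^ (-(1/2) - 1 : ℝ) = (t + 1) ^ (-(1/2) - 1 - 1 : ℝ) * (t + 1) := by
        nth_rewrite 3 [← Real.rpow_one (t + 1)]
        rw [← Real.rpow_add hp]
        norm_num
      have hz : 0 < (t + 1) ^ (-(1/2) - 1 - 1 : ℝ) := Real.rpow_pos_of_pos hp _
      rw [e1, e2]
      set z := (t + 1) ^ (-(1/2) - 1 - 1 : ℝ)
      have : 0 ≤ z * (t + 1) * ((n:ℝ) - 1) := by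
        apply mul_nonneg (by positivity) (by linarith)
      linarith)
    (fun t ht => Real.rpow_pos_of_pos (by linarith) _)
  have hpos : ∀ t, 0 ≤ t → 0 < wm t := fun t ht =>
    lt_of_lt_of_le (Real.rpow_pos_of_pos (by linarith) _) (hlow t ht)
  have hup := cmp_all ((n:ℝ) / 2) ((1 - ((n : ℝ) - 1) ^ 2 - 4 * Real.sqrt K) / 4)
    ((1 - ((n : ℝ) - 1) ^ 2 + 4 * Real.sqrt K) / 4) hm
    (by linarith) wp (deriv wp) (deriv (deriv wp)) wm (deriv wm) (deriv (deriv wm))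
    hcont_p hcont_m hp0 hm0
    (fun t ht => (smooth_derivs wp hsmooth_p t ht).1)
    (fun t ht => (smooth_derivs wp hsmooth_p t ht).2)
    (fun t ht => (smooth_derivs wm hsmooth_m t ht).1)
    (fun t ht => (smooth_derivs wm hsmooth_m t ht).2)
    hODEp (fun t ht => (hODEm t ht).le) hpos
  exact fun t ht => ⟨hpos t ht, hup t ht⟩
end

section
/- Let n ≥ 2 be an integer and K > 0, and let w₋ : [0,∞) → ℝ be continuous with w₋(0) = 1, twice continuously differentiable on (0,∞), satisfying t(t+1)·w₋''(t) + (2t + n/2)·w₋'(t) + ((1 − (n−1)² + 4√K)/4)·w₋(t) = 0 for all t > 0. Then the zero set {t > 0 : w₋(t) = 0} is unbounded (i.e. w₋ is oscillatory on (0,∞)) if and only if K > (n−1)⁴/16. -/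
open Real Set

lemma cp_not_localMax {f : ℝ → ℝ} {x : ℝ} (h2 : 0 < deriv (deriv f) x) (h1 : deriv f x = 0)
    (hc : ContinuousAt f x) (hm : IsLocalMax f x) : False := by
  have hmin := isLocalMin_of_deriv_deriv_pos h2 h1 hc
  have he : f =ᶠ[nhds x] fun _ => f x := by
    filter_upwards [hm, hmin] with y a b
    exact le_antisymm a b
  have h3 : deriv (deriv f) x = 0 := by
    rw [he.deriv.deriv_eq]
    simp
  linarith

lemma cp_zero_between (m c : ℝ) (hm : 1 ≤ m) (hc : c ≤ 1 / 4) (w w1 w2 : ℝ → ℝ)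
    (h1 : ∀ t, 0 < t → HasDerivAt w (w1 t) t) (h2 : ∀ t, 0 < t → HasDerivAt w1 (w2 t) t)
    (hode : ∀ t, 0 < t → t * (t + 1) * w2 t + (2 * t + m) * w1 t + c * w t = 0)
    (a b : ℝ) (ha : 0 < a) (hab : a < b) (wa : w a = 0) (wb : w b = 0) :
    ∀ t ∈ Icc a b, w t = 0 := by
  set g : ℝ → ℝ := fun t => w t ^ 2 * (t + 1 / 2) with hg
  have hg1 : ∀ t, 0 < t → HasDerivAt g (2 * w t * w1 t * (t + 1 / 2) + w t ^ 2) t := by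
    intro t ht
    have := ((h1 t ht).pow 2).mul ((hasDerivAt_id t).add_const (1 / 2 : ℝ))
    refine this.congr_deriv ?_
    simp
  have hg2 : ∀ t, 0 < t → HasDerivAt (fun t => 2 * w t * w1 t * (t + 1 / 2) + w t ^ 2)
      (2 * w1 t ^ 2 * (t + 1 / 2) + 2 * w t * w2 t * (t + 1 / 2) + 4 * w t * w1 t) t := by
    intro t ht
    have := ((((h1 t ht).const_mul 2).mul (h2 t ht)).mul
      ((hasDerivAt_id t).add_const (1 / 2 : ℝ))).add ((h1 t ht).pow 2)
    refine this.congr_deriv ?_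
    simp
    ring
  have hgc : ContinuousOn g (Icc a b) := fun t ht =>
    (hg1 t (lt_of_lt_of_le ha ht.1)).continuousAt.continuousWithinAt
  obtain ⟨x, hx, hmax⟩ := isCompact_Icc.exists_isMaxOn (nonempty_Icc.2 hab.le) hgc
  have hx0 : 0 < x := lt_of_lt_of_le ha hx.1
  have hwx : w x = 0 := by
    by_contra hne
    have hxa : x ≠ a := by rintro rfl; exact hne wa
    have hxb : x ≠ b := by rintro rfl; exact hne wb
    have hlm : IsLocalMax g x := hmax.isLocalMax
      (Icc_mem_nhds (lt_of_le_of_ne hx.1 (Ne.symm hxa)) (lt_of_le_of_ne hx.2 hxb))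
    have hd : deriv g x = 0 := hlm.deriv_eq_zero
    have hdd : deriv (deriv g) x = 2 * w1 x ^ 2 * (x + 1 / 2) + 2 * w x * w2 x * (x + 1 / 2)
        + 4 * w x * w1 x := by
      have : deriv g =ᶠ[nhds x] (fun t => 2 * w t * w1 t * (t + 1 / 2) + w t ^ 2) := by
        filter_upwards [Ioi_mem_nhds hx0] with y hy
        exact (hg1 y hy).deriv
      rw [this.deriv_eq, (hg2 x hx0).deriv]
    have e1 : 2 * w1 x * (x + 1 / 2) + w x = 0 := by
      rw [(hg1 x hx0).deriv] at hd
      have : w x * (2 * w1 x * (x + 1 / 2) + w x) = 0 := by linarith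
      exact (mul_eq_zero.1 this).resolve_left hne
    refine cp_not_localMax ?_ hd (hg1 x hx0).continuousAt hlm
    rw [hdd]
    have ho := hode x hx0
    set p := w1 x
    set q := w2 x
    have e2 : w x = -(2 * p * (x + 1 / 2)) := by linarith
    have hp : p ≠ 0 := by
      intro h; apply hne; rw [e2, h]; ring
    rw [e2] at ho ⊢
    have hpp : 0 < p ^ 2 := by positivity
    have key : x * (x + 1) * (2 * p ^ 2 * (x + 1 / 2) + 2 * -(2 * p * (x + 1 / 2)) * q * (x + 1 / 2)
        + 4 * -(2 * p * (x + 1 / 2)) * p)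
        = p ^ 2 * (x + 1 / 2) * (4 * (x + 1 / 2) * ((2 * x + m) - 2 * c * (x + 1 / 2))
          - 6 * (x * (x + 1))) := by
      linear_combination (-4 * p * (x + 1 / 2) ^ 2) * ho
    have hpos : 0 < 4 * (x + 1 / 2) * ((2 * x + m) - 2 * c * (x + 1 / 2)) - 6 * (x * (x + 1)) := by
      have : (2 * x + 1) - 1 / 2 * (x + 1 / 2) ≤ (2 * x + m) - 2 * c * (x + 1 / 2) := by nlinarith
      have := mul_le_mul_of_nonneg_left this (by positivity : 0 ≤ 4 * (x + 1 / 2))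
      nlinarith
    have : 0 < x * (x + 1) := by positivity
    refine pos_of_mul_pos_right (a := x * (x + 1)) ?_ this.le
    rw [key]
    positivity
  intro t ht
  have hle : g t ≤ g x := hmax ht
  have ht0 : 0 < t := lt_of_lt_of_le ha ht.1
  simp only [hg, hwx] at hle
  have : w t ^ 2 ≤ 0 := by
    by_contra h
    push Not at h
    have : 0 < w t ^ 2 * (t + 1 / 2) := by positivity
    linarith
  exact pow_eq_zero_iff (two_ne_zero) |>.1 (le_antisymm this (sq_nonneg _))

lemma cp_backward (m c : ℝ) (hm : 1 ≤ m) (w w1 w2 : ℝ → ℝ)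
    (h1 : ∀ t, 0 < t → HasDerivAt w (w1 t) t) (h2 : ∀ t, 0 < t → HasDerivAt w1 (w2 t) t)
    (hode : ∀ t, 0 < t → t * (t + 1) * w2 t + (2 * t + m) * w1 t + c * w t = 0)
    (d b : ℝ) (hd : 0 < d) (hdb : d ≤ b) (wb : w b = 0) (wb1 : w1 b = 0) : w d = 0 := by
  set M : ℝ := 2 * ((2 + m) / d) + 1 + |c| / d with hM
  set F : ℝ → ℝ := fun t => (w t ^ 2 + w1 t ^ 2) * exp (M * t) with hF
  have hF1 : ∀ t, 0 < t → HasDerivAt F ((2 * w t * w1 t + 2 * w1 t * w2 t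
      + M * (w t ^ 2 + w1 t ^ 2)) * exp (M * t)) t := by
    intro t ht
    have := (((h1 t ht).pow 2).add ((h2 t ht).pow 2)).mul (((hasDerivAt_id t).const_mul M).exp)
    refine this.congr_deriv ?_
    simp
    ring
  have hmono : MonotoneOn F (Ici d) := by
    refine monotoneOn_of_deriv_nonneg (convex_Ici d)
      (fun t ht => (hF1 t (lt_of_lt_of_le hd ht)).continuousAt.continuousWithinAt) ?_ ?_
    · intro t ht
      rw [interior_Ici] at ht
      exact (hF1 t (hd.trans ht)).differentiableAt.differentiableWithinAt
    · intro t ht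
      rw [interior_Ici] at ht
      have htd : d < t := ht
      have ht0 : 0 < t := hd.trans ht
      rw [(hF1 t ht0).deriv]
      refine mul_nonneg ?_ (exp_pos _).le
      have hw2 : w2 t = -((2 * t + m) / (t * (t + 1))) * w1 t - c / (t * (t + 1)) * w t := by
        have := hode t ht0
        field_simp
        linarith
      have hA : (2 * t + m) / (t * (t + 1)) ≤ (2 + m) / d := by
        rw [div_le_div_iff₀ (by positivity) hd]
        have : 2 * t + m ≤ (2 + m) * (t + 1) := by nlinarith
        calc (2 * t + m) * d ≤ ((2 + m) * (t + 1)) * t := by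
              apply mul_le_mul this htd.le hd.le; positivity
          _ = _ := by ring
      have hB : |c / (t * (t + 1))| ≤ |c| / d := by
        rw [abs_div, abs_of_pos (by positivity : 0 < t * (t + 1))]
        apply div_le_div_of_nonneg_left (abs_nonneg c) hd
        nlinarith
      rw [hw2]
      set A := (2 * t + m) / (t * (t + 1))
      set B := c / (t * (t + 1))
      set Ab := (2 + m) / d
      set Bb := |c| / d
      obtain ⟨hB1, hB2⟩ := abs_le.1 hB
      have hAb0 : 0 ≤ Ab := by positivity
      rw [hM]
      nlinarith [sq_nonneg (w t + w1 t), sq_nonneg (w t - w1 t),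
        mul_nonneg (sub_nonneg.2 hA) (sq_nonneg (w1 t)), mul_nonneg hAb0 (sq_nonneg (w t)),
        mul_nonneg (sub_nonneg.2 hB2) (sq_nonneg (w t + w1 t)),
        mul_nonneg (by linarith : 0 ≤ Bb + B) (sq_nonneg (w t - w1 t))]
  have h := hmono (mem_Ici.2 le_rfl) (mem_Ici.2 hdb) hdb
  simp only [hF, wb, wb1] at h
  have hE := exp_pos (M * d)
  have : w d ^ 2 + w1 d ^ 2 ≤ 0 := by
    by_contra hh
    push Not at hh
    have := mul_pos hh hE
    linarith
  have : w d ^ 2 = 0 := by nlinarith [sq_nonneg (w d), sq_nonneg (w1 d)]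
  exact pow_eq_zero_iff (two_ne_zero) |>.1 this

lemma cp_osc (m c : ℝ) (hc : 1 / 4 < c) (w w1 w2 : ℝ → ℝ)
    (h1 : ∀ t, 0 < t → HasDerivAt w (w1 t) t) (h2 : ∀ t, 0 < t → HasDerivAt w1 (w2 t) t)
    (hode : ∀ t, 0 < t → t * (t + 1) * w2 t + (2 * t + m) * w1 t + c * w t = 0)
    (B : ℝ) (hB : ∀ t, 0 < t → w t = 0 → t ≤ B) : False := by
  set δ : ℝ := min (c - 1 / 4) 1 with hδ
  have hδ0 : 0 < δ := lt_min (by linarith) one_pos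
  have hδ1 : δ ≤ 1 := min_le_right _ _
  have hδ2 : δ ≤ c - 1 / 4 := min_le_left _ _
  set C : ℝ := |2 - m| + |c| with hC
  set T : ℝ := max (max B 0) (2 * C / δ) + 1 with hT
  have hTB : B < T := by
    have := (le_max_left B 0).trans (le_max_left (max B 0) (2 * C / δ)); linarith
  have hT0 : 0 < T := by
    have := (le_max_right B 0).trans (le_max_left (max B 0) (2 * C / δ)); linarith
  have hTC : 2 * C / δ < T := by
    have := (le_max_right (max B 0) (2 * C / δ)); linarith
  have hne : ∀ t, T ≤ t → w t ≠ 0 := fun t ht h => by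
    have := hB t (by linarith) h
    linarith
  set z : ℝ → ℝ := fun t => t * w1 t / w t + 1 / 2 with hz
  set F : ℝ → ℝ := fun t => arctan (z t) + δ / 2 * log t with hF
  have hz1 : ∀ t, T ≤ t → HasDerivAt z
      (((w1 t + t * w2 t) * w t - t * w1 t * w1 t) / w t ^ 2) t := by
    intro t ht
    have ht0 : 0 < t := hT0.trans_le ht
    have := (((hasDerivAt_id t).mul (h2 t ht0)).div (h1 t ht0) (hne t ht)).add_const (1 / 2 : ℝ)
    refine this.congr_deriv ?_
    simp
  have hF1 : ∀ t, T ≤ t → HasDerivAt F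
      (1 / (1 + z t ^ 2) * (((w1 t + t * w2 t) * w t - t * w1 t * w1 t) / w t ^ 2)
        + δ / 2 * t⁻¹) t := by
    intro t ht
    exact (hz1 t ht).arctan.add ((hasDerivAt_log (hT0.trans_le ht).ne').const_mul _)
  have hanti : AntitoneOn F (Ici T) := by
    refine antitoneOn_of_deriv_nonpos (convex_Ici T)
      (fun t ht => (hF1 t ht).continuousAt.continuousWithinAt) ?_ ?_
    · intro t ht
      rw [interior_Ici] at ht
      exact (hF1 t (le_of_lt ht)).differentiableAt.differentiableWithinAt
    · intro t ht
      rw [interior_Ici] at ht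
      have htT : T < t := ht
      have ht0 : 0 < t := hT0.trans ht
      rw [(hF1 t htT.le).deriv]
      have hw := hne t htT.le
      have hzd : ((w1 t + t * w2 t) * w t - t * w1 t * w1 t) / w t ^ 2
          = (-(z t ^ 2 + (c - 1 / 4)) + ((2 - m) * (z t - 1 / 2) + c) / (t + 1)) / t := by
        have ho := hode t ht0
        have hw2 : w2 t = -((2 * t + m) * w1 t + c * w t) / (t * (t + 1)) := by
          field_simp
          linarith
        rw [hw2]
        simp only [hz]
        field_simp
        ring
      rw [hzd]
      set y := z t
      have hpert : ((2 - m) * (y - 1 / 2) + c) / (t + 1) ≤ δ / 2 * (1 + y ^ 2) := by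
        rw [div_le_iff₀ (by positivity)]
        have a1 : (2 - m) * (y - 1 / 2) ≤ |2 - m| * (1 + y ^ 2) := by
          calc (2 - m) * (y - 1 / 2) ≤ |(2 - m) * (y - 1 / 2)| := le_abs_self _
            _ = |2 - m| * |y - 1 / 2| := abs_mul _ _
            _ ≤ _ := by
              apply mul_le_mul_of_nonneg_left _ (abs_nonneg _)
              rw [abs_le]
              constructor <;> nlinarith [sq_nonneg (y - 1 / 2), sq_nonneg (y + 1 / 2)]
        have a2 : c ≤ |c| * (1 + y ^ 2) := by
          nlinarith [le_abs_self c, abs_nonneg c, sq_nonneg y,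
            mul_nonneg (abs_nonneg c) (sq_nonneg y)]
        have a3 : 2 * C < T * δ := (div_lt_iff₀ hδ0).1 hTC
        have a4 : C ≤ δ / 2 * (t + 1) := by nlinarith
        have a5 := mul_le_mul_of_nonneg_right a4 (by positivity : 0 ≤ 1 + y ^ 2)
        calc _ ≤ C * (1 + y ^ 2) := by rw [hC]; linarith
          _ ≤ _ := by linarith
      have hmain : -(y ^ 2 + (c - 1 / 4)) + ((2 - m) * (y - 1 / 2) + c) / (t + 1)
          ≤ -(δ / 2 * (1 + y ^ 2)) := by
        nlinarith [mul_nonneg (sub_nonneg.2 hδ1) (sq_nonneg y)]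
      have hy : 0 < 1 + y ^ 2 := by positivity
      calc _ ≤ 1 / (1 + y ^ 2) * (-(δ / 2 * (1 + y ^ 2)) / t) + δ / 2 * t⁻¹ := by gcongr
        _ = 0 := by field_simp; ring
        _ ≤ 0 := le_rfl
  have hlim : Filter.Tendsto (fun t => δ / 2 * log t) Filter.atTop Filter.atTop :=
    tendsto_log_atTop.const_mul_atTop (by positivity)
  obtain ⟨t, ht, ht2⟩ := ((hlim.eventually_gt_atTop (F T + π / 2)).and
    (Filter.eventually_ge_atTop T)).exists
  have := hanti (mem_Ici.2 le_rfl) (mem_Ici.2 ht2) ht2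
  have h3 := neg_pi_div_two_lt_arctan (z t)
  have h4 : F t = arctan (z t) + δ / 2 * log t := rfl
  linarith

theorem clamped_plate_stmt2
    (n : ℕ) (hn : 2 ≤ n) (K : ℝ) (hK : 0 < K) (wm : ℝ → ℝ)
    (hcont : ContinuousOn wm (Set.Ici 0))
    (hw0 : wm 0 = 1)
    (hsmooth : ContDiffOn ℝ 2 wm (Set.Ioi 0))
    (hODE : ∀ t : ℝ, 0 < t →
      t * (t + 1) * deriv (deriv wm) t + (2 * t + (n : ℝ) / 2) * deriv wm t
        + ((1 - ((n : ℝ) - 1) ^ 2 + 4 * Real.sqrt K) / 4) * wm t = 0) :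
    ¬ BddAbove {t : ℝ | 0 < t ∧ wm t = 0} ↔ ((n : ℝ) - 1) ^ 4 / 16 < K := by
  have hn2 : (2 : ℝ) ≤ n := by exact_mod_cast hn
  have h1 : ∀ t, 0 < t → HasDerivAt wm (deriv wm t) t := fun t ht =>
    ((hsmooth.differentiableOn (by norm_num)).differentiableAt (Ioi_mem_nhds ht)).hasDerivAt
  have hs2 : ContDiffOn ℝ 1 (deriv wm) (Ioi 0) :=
    hsmooth.deriv_of_isOpen isOpen_Ioi (by norm_num)
  have h2 : ∀ t, 0 < t → HasDerivAt (deriv wm) (deriv (deriv wm) t) t := fun t ht =>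
    ((hs2.differentiableOn (by norm_num)).differentiableAt (Ioi_mem_nhds ht)).hasDerivAt
  have hm : 1 ≤ (n : ℝ) / 2 := by linarith
  have hKiff : ((n : ℝ) - 1) ^ 4 / 16 < K ↔
      1 / 4 < (1 - ((n : ℝ) - 1) ^ 2 + 4 * Real.sqrt K) / 4 := by
    have h := Real.lt_sqrt (x := ((n : ℝ) - 1) ^ 2 / 4) (y := K) (by positivity)
    have e : (((n : ℝ) - 1) ^ 2 / 4) ^ 2 = ((n : ℝ) - 1) ^ 4 / 16 := by ring
    rw [e] at h
    rw [← h]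
    constructor <;> intro h <;> linarith
  rw [hKiff]
  constructor
  · intro hunb
    by_contra hle
    push Not at hle
    rw [not_bddAbove_iff] at hunb
    obtain ⟨a, ⟨ha, wa⟩, -⟩ := hunb 0
    obtain ⟨b, ⟨hb, wb⟩, hab⟩ := hunb a
    have hz := cp_zero_between _ _ hm hle wm _ _ h1 h2 hODE a b ha hab wa wb
    set x := (a + b) / 2 with hx
    have hax : a < x := by rw [hx]; linarith
    have hxb : x < b := by rw [hx]; linarith
    have hx0 : wm x = 0 := hz x ⟨hax.le, hxb.le⟩
    have hx1 : deriv wm x = 0 := by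
      have : wm =ᶠ[nhds x] fun _ => 0 := by
        filter_upwards [Icc_mem_nhds hax hxb] with y hy
        exact hz y hy
      rw [this.deriv_eq]
      simp
    have hall : ∀ d ∈ Ioc 0 x, wm d = 0 := fun d hd =>
      cp_backward _ _ hm wm _ _ h1 h2 hODE d x hd.1 hd.2 hx0 hx1
    have hc0 : Filter.Tendsto wm (nhdsWithin 0 (Ioi 0)) (nhds (wm 0)) :=
      ((hcont 0 (mem_Ici.2 le_rfl)).mono Ioi_subset_Ici_self)
    have hc1 : Filter.Tendsto wm (nhdsWithin 0 (Ioi 0)) (nhds 0) := by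
      refine tendsto_const_nhds.congr' ?_
      filter_upwards [Ioc_mem_nhdsGT (ha.trans hax)] with y hy
      exact (hall y hy).symm
    have := tendsto_nhds_unique hc0 hc1
    rw [hw0] at this
    exact one_ne_zero this
  · rintro hc ⟨B, hB⟩
    exact cp_osc _ _ hc wm _ _ h1 h2 hODE B (fun t ht h => hB ⟨ht, h⟩)
end

section
/- Let κ > 0 and s > 0. For λ > κ define Λ₋(λ) = 2·√(λ²/κ² − 1), Λ₊(λ) = 2·√(λ²/κ² + 1), and f(λ) = Λ₋(λ)·cot(Λ₋(λ)·s) − Λ₊(λ)·coth(Λ₊(λ)·s), defined whenever sin(Λ₋(λ)·s) ≠ 0. Then f is strictly decreasing on every interval I ⊆ (κ, ∞) on which sin(Λ₋(λ)·s) ≠ 0 for all λ ∈ I. -/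
open Real Set

theorem aux_cot (s a b : ℝ) (hs : 0 < s) (ha : 0 < a) (hab : a < b)
    (h : ∀ x ∈ Set.Icc a b, Real.sin (x * s) ≠ 0) :
    b * Real.cos (b * s) / Real.sin (b * s) < a * Real.cos (a * s) / Real.sin (a * s) := by
  have hd : ∀ x ∈ Set.Icc a b, HasDerivAt (fun x : ℝ => x * Real.cos (x * s) / Real.sin (x * s))
      ((Real.sin (x * s) * Real.cos (x * s) - x * s) / Real.sin (x * s) ^ 2) x := by
    intro x hx
    have h1 : HasDerivAt (fun x : ℝ => x * s) s x := by
      simpa using (hasDerivAt_id x).mul_const s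
    have h2 := ((hasDerivAt_id x).mul h1.cos).div h1.sin (h x hx)
    refine h2.congr_deriv ?_
    congr 1
    have := Real.sin_sq_add_cos_sq (x * s)
    simp only [id, Pi.mul_apply]
    linear_combination (-x * s) * this
  have := strictAntiOn_of_deriv_neg (convex_Icc a b)
    (fun x hx => (hd x hx).continuousAt.continuousWithinAt) (by
      intro x hx
      rw [interior_Icc] at hx
      have hx' := Set.Ioo_subset_Icc_self hx
      rw [(hd x hx').deriv]
      have hxs : 0 < x * s := mul_pos (ha.trans hx.1) hs
      have h3 := Real.sin_lt (x := 2 * (x * s)) (by positivity)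
      rw [Real.sin_two_mul] at h3
      exact div_neg_of_neg_of_pos (by linarith) (by have := h x hx'; positivity))
  exact this (Set.left_mem_Icc.2 hab.le) (Set.right_mem_Icc.2 hab.le) hab

theorem aux_coth (s a b : ℝ) (hs : 0 < s) (ha : 0 < a) (hab : a < b) :
    a * Real.cosh (a * s) / Real.sinh (a * s) < b * Real.cosh (b * s) / Real.sinh (b * s) := by
  have h : ∀ x ∈ Set.Icc a b, Real.sinh (x * s) ≠ 0 := fun x hx =>
    (Real.sinh_pos_iff.2 (mul_pos (ha.trans_le hx.1) hs)).ne'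
  have hd : ∀ x ∈ Set.Icc a b,
      HasDerivAt (fun x : ℝ => x * Real.cosh (x * s) / Real.sinh (x * s))
      ((Real.sinh (x * s) * Real.cosh (x * s) - x * s) / Real.sinh (x * s) ^ 2) x := by
    intro x hx
    have h1 : HasDerivAt (fun x : ℝ => x * s) s x := by
      simpa using (hasDerivAt_id x).mul_const s
    have h2 := ((hasDerivAt_id x).mul h1.cosh).div h1.sinh (h x hx)
    refine h2.congr_deriv ?_
    congr 1
    have := Real.cosh_sq (x * s)
    simp only [id, Pi.mul_apply]
    linear_combination (-x * s) * this
  have := strictMonoOn_of_deriv_pos (convex_Icc a b)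
    (fun x hx => (hd x hx).continuousAt.continuousWithinAt) (by
      intro x hx
      rw [interior_Icc] at hx
      have hx' := Set.Ioo_subset_Icc_self hx
      rw [(hd x hx').deriv]
      have hxs : 0 < x * s := mul_pos (ha.trans hx.1) hs
      have h3 := Real.self_lt_sinh_iff.2 (show 0 < 2 * (x * s) by positivity)
      rw [Real.sinh_two_mul] at h3
      exact div_pos (by linarith) (by have := h x hx'; positivity))
  exact this (Set.left_mem_Icc.2 hab.le) (Set.right_mem_Icc.2 hab.le) hab

theorem clamped_plate_stmt8
    (κ s : ℝ) (hκ : 0 < κ) (hs : 0 < s) :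
    ∀ I : Set ℝ, I ⊆ Set.Ioi κ → I.OrdConnected →
      (∀ l ∈ I, Real.sin (2 * Real.sqrt (l ^ 2 / κ ^ 2 - 1) * s) ≠ 0) →
      StrictAntiOn (fun l : ℝ =>
        2 * Real.sqrt (l ^ 2 / κ ^ 2 - 1) *
            Real.cos (2 * Real.sqrt (l ^ 2 / κ ^ 2 - 1) * s) /
            Real.sin (2 * Real.sqrt (l ^ 2 / κ ^ 2 - 1) * s)
          - 2 * Real.sqrt (l ^ 2 / κ ^ 2 + 1) *
            Real.cosh (2 * Real.sqrt (l ^ 2 / κ ^ 2 + 1) * s) /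
            Real.sinh (2 * Real.sqrt (l ^ 2 / κ ^ 2 + 1) * s)) I := by
  intro I hI hc h l hl m hm hlm
  have hl0 : κ < l := hI hl
  have hq : l ^ 2 / κ ^ 2 < m ^ 2 / κ ^ 2 := by
    have : l ^ 2 < m ^ 2 := by nlinarith
    gcongr
  have hq1 : 1 < l ^ 2 / κ ^ 2 := by
    rw [one_lt_div (by positivity)]
    nlinarith
  have hA := aux_coth s (2 * √(l ^ 2 / κ ^ 2 + 1)) (2 * √(m ^ 2 / κ ^ 2 + 1)) hs
    (by positivity) (by
      have := Real.sqrt_lt_sqrt (by positivity) (add_lt_add_left hq 1)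
      linarith)
  have ha : 0 < √(l ^ 2 / κ ^ 2 - 1) := Real.sqrt_pos.2 (by linarith)
  have hB := aux_cot s (2 * √(l ^ 2 / κ ^ 2 - 1)) (2 * √(m ^ 2 / κ ^ 2 - 1)) hs
    (by positivity) (by
      have := Real.sqrt_lt_sqrt (by linarith) (sub_lt_sub_right hq 1)
      linarith) (by
      intro x hx
      have hx0 : 0 < x := by linarith [hx.1]
      have e1 := Real.sq_sqrt (show 0 ≤ l ^ 2 / κ ^ 2 - 1 by linarith)
      have e2 := Real.sq_sqrt (show 0 ≤ m ^ 2 / κ ^ 2 - 1 by linarith)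
      have f1 : l ^ 2 / κ ^ 2 ≤ x ^ 2 / 4 + 1 := by nlinarith [hx.1]
      have f2 : x ^ 2 / 4 + 1 ≤ m ^ 2 / κ ^ 2 := by nlinarith [hx.2]
      rw [div_le_iff₀ (by positivity)] at f1
      rw [le_div_iff₀ (by positivity)] at f2
      have e3 := Real.sq_sqrt (show 0 ≤ x ^ 2 / 4 + 1 by positivity)
      have hmem : κ * √(x ^ 2 / 4 + 1) ∈ I := by
        refine hc.out hl hm ⟨?_, ?_⟩
        · refine (pow_le_pow_iff_left₀ (by first | positivity | linarith) (by positivity) two_ne_zero).1 ?_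
          rw [mul_pow, e3]; linarith
        · refine (pow_le_pow_iff_left₀ (by first | positivity | linarith) (by linarith) two_ne_zero).1 ?_
          rw [mul_pow, e3]; linarith
      have := h _ hmem
      have e4 : (κ * √(x ^ 2 / 4 + 1)) ^ 2 / κ ^ 2 - 1 = (x / 2) ^ 2 := by
        rw [mul_pow, e3]; field_simp; ring
      rw [e4, Real.sqrt_sq (by positivity)] at this
      convert this using 2
      ring)
  simp only
  linarith
end

section
/- Let κ > 0 and L > 0. Define F_L : (0,∞) → ℝ by F_L(λ) = 2√(1 − λ²/κ²)·coth(√(1 − λ²/κ²)·κL) − 2√(λ²/κ² + 1)·coth(√(λ²/κ² + 1)·κL) for 0 < λ < κ, F_L(κ) = 2/(κL) − 2√2·coth(√2·κL), and F_L(λ) = 2√(λ²/κ² − 1)·cot(√(λ²/κ² − 1)·κL) − 2√(λ²/κ² + 1)·coth(√(λ²/κ² + 1)·κL) for λ > κ (the last expression considered where sin(√(λ²/κ² − 1)·κL) ≠ 0). Then F_L(λ) ≠ 0 for all λ ∈ (0, κ], the set of zeros of F_L in (κ, ∞) is nonempty and has a smallest element λ*(L), and κ·√(1 + (π/(κL))²)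 ≤ λ*(L) ≤ κ·√(1 + (2π/(κL))²). -/
open Real Set

lemma cp_sinh_lt (y : ℝ) (hy : 0 < y) : Real.sinh y < y * Real.cosh y := by
  have hd : ∀ x : ℝ, HasDerivAt (fun x : ℝ => x * Real.cosh x - Real.sinh x) (x * Real.sinh x) x := by
    intro x
    have := ((hasDerivAt_id x).mul (Real.hasDerivAt_cosh x)).sub (Real.hasDerivAt_sinh x)
    refine this.congr_deriv ?_
    try simp only [id]
    ring
  have hm : StrictMonoOn (fun x : ℝ => x * Real.cosh x - Real.sinh x) (Ici 0) := by
    apply strictMonoOn_of_deriv_pos (convex_Ici 0)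
    · exact fun x _ => (hd x).continuousAt.continuousWithinAt
    · intro x hx
      rw [interior_Ici] at hx
      rw [(hd x).deriv]
      exact mul_pos hx (Real.sinh_pos_iff.2 hx)
  have := hm (mem_Ici.2 le_rfl) (mem_Ici.2 hy.le) hy
  simp at this
  linarith

lemma cp_cos_lt (y : ℝ) (hy : 0 < y) (hp : y ≤ π) : y * Real.cos y < Real.sin y := by
  have hd : ∀ x : ℝ, HasDerivAt (fun x : ℝ => Real.sin x - x * Real.cos x) (x * Real.sin x) x := by
    intro x
    have := (Real.hasDerivAt_sin x).sub ((hasDerivAt_id x).mul (Real.hasDerivAt_cos x))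
    refine this.congr_deriv ?_
    try simp only [id]
    ring
  have hm : StrictMonoOn (fun x : ℝ => Real.sin x - x * Real.cos x) (Icc 0 π) := by
    apply strictMonoOn_of_deriv_pos (convex_Icc 0 π)
    · exact fun x _ => (hd x).continuousAt.continuousWithinAt
    · intro x hx
      rw [interior_Icc] at hx
      rw [(hd x).deriv]
      exact mul_pos hx.1 (Real.sin_pos_of_pos_of_lt_pi hx.1 hx.2)
  have := hm ⟨le_rfl, Real.pi_pos.le⟩ ⟨hy.le, hp⟩ hy
  simp at this
  linarith

lemma cp_ratio (u v : ℝ) (hu : 0 < u) (huv : u < v) : v * Real.sinh u < u * Real.sinh v := by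
  have hd : ∀ x : ℝ, HasDerivAt (fun x : ℝ => u * Real.sinh x - x * Real.sinh u)
      (u * Real.cosh x - Real.sinh u) x := by
    intro x
    have := ((Real.hasDerivAt_sinh x).const_mul u).sub ((hasDerivAt_id x).mul_const (Real.sinh u))
    refine this.congr_deriv ?_
    try simp only [id]
    ring
  have hm : StrictMonoOn (fun x : ℝ => u * Real.sinh x - x * Real.sinh u) (Ici u) := by
    apply strictMonoOn_of_deriv_pos (convex_Ici u)
    · exact fun x _ => (hd x).continuousAt.continuousWithinAt
    · intro x hx
      rw [interior_Ici] at hx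
      have hx' : u < x := hx
      rw [(hd x).deriv]
      have h1 := cp_sinh_lt u hu
      have h2 : Real.cosh u ≤ Real.cosh x := by
        rw [Real.cosh_le_cosh, abs_of_pos hu, abs_of_pos (hu.trans hx')]
        exact hx'.le
      nlinarith
  have := hm (mem_Ici.2 le_rfl) (mem_Ici.2 huv.le) huv
  simp at this
  linarith

lemma cp_coth (x y : ℝ) (hx : 0 < x) (hxy : x < y) :
    x * Real.cosh x * Real.sinh y < y * Real.cosh y * Real.sinh x := by
  have h := cp_ratio (y - x) (x + y) (by linarith) (by linarith)
  rw [Real.sinh_sub, Real.sinh_add] at h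
  nlinarith

theorem clamped_plate_stmt9
    (κ L : ℝ) (hκ : 0 < κ) (hL : 0 < L) (F : ℝ → ℝ)
    (hF_lt : ∀ l : ℝ, 0 < l → l < κ → F l =
      2 * Real.sqrt (1 - l ^ 2 / κ ^ 2) *
          Real.cosh (Real.sqrt (1 - l ^ 2 / κ ^ 2) * (κ * L)) /
          Real.sinh (Real.sqrt (1 - l ^ 2 / κ ^ 2) * (κ * L))
        - 2 * Real.sqrt (l ^ 2 / κ ^ 2 + 1) *
          Real.cosh (Real.sqrt (l ^ 2 / κ ^ 2 + 1) * (κ * L)) /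
          Real.sinh (Real.sqrt (l ^ 2 / κ ^ 2 + 1) * (κ * L)))
    (hF_eq : F κ = 2 / (κ * L)
        - 2 * Real.sqrt 2 * Real.cosh (Real.sqrt 2 * (κ * L)) /
            Real.sinh (Real.sqrt 2 * (κ * L)))
    (hF_gt : ∀ l : ℝ, κ < l → F l =
      2 * Real.sqrt (l ^ 2 / κ ^ 2 - 1) *
          Real.cos (Real.sqrt (l ^ 2 / κ ^ 2 - 1) * (κ * L)) /
          Real.sin (Real.sqrt (l ^ 2 / κ ^ 2 - 1) * (κ * L))
        - 2 * Real.sqrt (l ^ 2 / κ ^ 2 + 1) *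
          Real.cosh (Real.sqrt (l ^ 2 / κ ^ 2 + 1) * (κ * L)) /
          Real.sinh (Real.sqrt (l ^ 2 / κ ^ 2 + 1) * (κ * L))) :
    (∀ l : ℝ, 0 < l → l ≤ κ → F l ≠ 0) ∧
    ∃ lstar : ℝ, IsLeast {l : ℝ | κ < l ∧ F l = 0} lstar ∧
      κ * Real.sqrt (1 + (Real.pi / (κ * L)) ^ 2) ≤ lstar ∧
      lstar ≤ κ * Real.sqrt (1 + (2 * Real.pi / (κ * L)) ^ 2) := by
  have hM : 0 < κ * L := mul_pos hκ hL
  generalize hMd : κ * L = M at *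
  have hκ2 : 0 < κ ^ 2 := by positivity
  refine ⟨?_, ?_⟩
  · intro l hl hlk
    rcases hlk.lt_or_eq with hlt | rfl
    · rw [hF_lt l hl hlt]
      have hq : 0 < l ^ 2 / κ ^ 2 := by positivity
      have hq1 : l ^ 2 / κ ^ 2 < 1 := by
        rw [div_lt_one hκ2]; nlinarith
      have ha : 0 < Real.sqrt (1 - l ^ 2 / κ ^ 2) := Real.sqrt_pos.2 (by linarith)
      have hab : Real.sqrt (1 - l ^ 2 / κ ^ 2) < Real.sqrt (l ^ 2 / κ ^ 2 + 1) :=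
        Real.sqrt_lt_sqrt (by linarith) (by linarith)
      generalize Real.sqrt (1 - l ^ 2 / κ ^ 2) = a at *
      generalize Real.sqrt (l ^ 2 / κ ^ 2 + 1) = b at *
      have h := cp_coth (a * M) (b * M) (by positivity) (by nlinarith)
      have hs1 : 0 < Real.sinh (a * M) := Real.sinh_pos_iff.2 (by positivity)
      have hs2 : 0 < Real.sinh (b * M) :=
        Real.sinh_pos_iff.2 (mul_pos (ha.trans hab) hM)
      apply ne_of_lt
      rw [sub_neg, div_lt_div_iff₀ hs1 hs2]
      nlinarith
    · rw [hF_eq]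
      have hb : 0 < Real.sqrt 2 := by positivity
      generalize Real.sqrt 2 = b at *
      have hs2 : 0 < Real.sinh (b * M) := Real.sinh_pos_iff.2 (by positivity)
      have h := cp_sinh_lt (b * M) (by positivity)
      apply ne_of_lt
      rw [sub_neg, div_lt_div_iff₀ hM hs2]
      nlinarith
  · set x : ℝ → ℝ := fun l => Real.sqrt (l ^ 2 / κ ^ 2 - 1) * M with hxd
    set y : ℝ → ℝ := fun l => Real.sqrt (l ^ 2 / κ ^ 2 + 1) * M with hyd
    set G : ℝ → ℝ := fun l => x l * Real.cos (x l) * Real.sinh (y l)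
      - y l * Real.cosh (y l) * Real.sin (x l) with hG
    have hy : ∀ l, 0 < y l := fun l => mul_pos (Real.sqrt_pos.2 (by positivity)) hM
    have hsy : ∀ l, 0 < Real.sinh (y l) := fun l => Real.sinh_pos_iff.2 (hy l)
    have hx : ∀ l, κ < l → 0 < x l := by
      intro l hl
      refine mul_pos (Real.sqrt_pos.2 ?_) hM
      rw [sub_pos, one_lt_div hκ2]; nlinarith
    have hGc : Continuous G := by
      simp only [hG, hxd, hyd]
      fun_prop
    have key : ∀ l, κ < l → (F l = 0 ↔ G l = 0) := by
      intro l hl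
      have hFl : M * F l * Real.sinh (y l) = 2 * (x l * Real.cos (x l) / Real.sin (x l) * Real.sinh (y l)
          - y l * Real.cosh (y l)) := by
        rw [hF_gt l hl]
        have := (hsy l).ne'
        simp only [hxd, hyd] at this ⊢
        field_simp
      by_cases hs : Real.sin (x l) = 0
      · have hc : Real.cos (x l) ≠ 0 := by
          intro hc
          have := Real.sin_sq_add_cos_sq (x l)
          rw [hs, hc] at this
          norm_num at this
        constructor
        · intro h0
          rw [h0, hs] at hFl
          have := mul_pos (hy l) (Real.cosh_pos (y l))
          simp at hFl
          rcases hFl with h | h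
          · exact absurd h (hy l).ne'
          · exact absurd h (Real.cosh_pos _).ne'
        · intro h0
          simp only [hG, hs] at h0
          simp [hc, (hx l hl).ne', (hsy l).ne'] at h0
      · have h2 : M * F l * Real.sinh (y l) * Real.sin (x l) = 2 * G l := by
          rw [hFl]
          simp only [hG]
          field_simp
        constructor
        · intro h0
          rw [h0] at h2
          linarith
        · intro h0
          rw [h0] at h2
          simpa [hM.ne', (hsy l).ne', hs] using h2
    have hxval : ∀ p : ℝ, 0 < p → x (κ * Real.sqrt (1 + (p / M) ^ 2)) = p := by
      intro p hp
      have h1 : (κ * Real.sqrt (1 + (p / M) ^ 2)) ^ 2 / κ ^ 2 - 1 = (p / M) ^ 2 := by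
        rw [mul_pow, Real.sq_sqrt (by positivity)]
        field_simp
        ring
      simp only [hxd]
      rw [h1, Real.sqrt_sq (by positivity)]
      field_simp
    have hlow : ∀ l, κ < l → G l = 0 → π < x l := by
      intro l hl h0
      by_contra hle
      push Not at hle
      have h1 := cp_cos_lt (x l) (hx l hl) hle
      have h2 := cp_sinh_lt (y l) (hy l)
      have h3 := Real.sin_nonneg_of_nonneg_of_le_pi (hx l hl).le hle
      simp only [hG] at h0
      nlinarith [hsy l]
    set l1 := κ * Real.sqrt (1 + (π / M) ^ 2) with hl1
    set l2 := κ * Real.sqrt (1 + (2 * π / M) ^ 2) with hl2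
    have hpi := Real.pi_pos
    have hκl1 : κ < l1 := by
      have : 1 < Real.sqrt (1 + (π / M) ^ 2) := by
        rw [Real.lt_sqrt (by norm_num)]
        have : 0 < (π / M) ^ 2 := by positivity
        linarith
      nlinarith
    have hx1 : x l1 = π := hxval π hpi
    have hx2 : x l2 = 2 * π := hxval (2 * π) (by positivity)
    have hmono : ∀ l l', 0 ≤ l → l ≤ l' → x l ≤ x l' := by
      intro l l' h0 h
      simp only [hxd]
      gcongr
    have hl10 : 0 < l1 := hκ.trans hκl1
    have hl20 : 0 ≤ l2 := by positivity
    have hl12 : l1 ≤ l2 := by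
      by_contra h
      push Not at h
      have := hmono l2 l1 hl20 h.le
      rw [hx1, hx2] at this
      linarith
    have hg1 : G l1 ≤ 0 := by
      simp only [hG, hx1, Real.cos_pi, Real.sin_pi]
      nlinarith [hsy l1]
    have hg2 : 0 ≤ G l2 := by
      simp only [hG, hx2, Real.cos_two_pi, Real.sin_two_pi]
      nlinarith [hsy l2]
    obtain ⟨c, hc, hc0⟩ := intermediate_value_Icc hl12 hGc.continuousOn ⟨hg1, hg2⟩
    have hcomp : IsCompact (Icc l1 l2 ∩ G ⁻¹' {0}) :=
      isCompact_Icc.inter_right (isClosed_singleton.preimage hGc)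
    obtain ⟨m, hm⟩ := hcomp.exists_isLeast ⟨c, hc, hc0⟩
    have hm1 : l1 ≤ m := hm.1.1.1
    have hm2 : m ≤ l2 := hm.1.1.2
    have hm0 : G m = 0 := hm.1.2
    have hκm : κ < m := hκl1.trans_le hm1
    refine ⟨m, ⟨⟨hκm, (key m hκm).2 hm0⟩, ?_⟩, hm1, hm2⟩
    rintro l ⟨hl, hFl⟩
    have hGl := (key l hl).1 hFl
    have hxl := hlow l hl hGl
    have hl1l : l1 ≤ l := by
      by_contra h
      push Not at h
      have := hmono l l1 (hκ.trans hl).le h.le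
      linarith
    rcases le_total l l2 with h | h
    · exact hm.2 ⟨⟨hl1l, h⟩, hGl⟩
    · exact hm2.trans h
end

section
/- Let κ > 0, and for each L > 0 let λ*(L) be the smallest zero in (κ, ∞) of the function F_L(λ) = 2√(λ²/κ² − 1)·cot(√(λ²/κ² − 1)·κL) − 2√(λ²/κ² + 1)·coth(√(λ²/κ² + 1)·κL). Then λ*(L) → κ as L → ∞; consequently λ*(L)⁴ → κ⁴ as L → ∞. -/
open Real Set Filter

lemma exists_root_aux (M : ℝ) (hM : 0 < M) : ∃ s ∈ Ioo (π / M) (2 * π / M),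
    s * Real.cos (s * M) * Real.sinh (√(s ^ 2 + 2) * M)
      - √(s ^ 2 + 2) * Real.cosh (√(s ^ 2 + 2) * M) * Real.sin (s * M) = 0 := by
  have hpi := Real.pi_pos
  have hle : π / M ≤ 2 * π / M := by gcongr; linarith
  have hc : ContinuousOn (fun s : ℝ => s * Real.cos (s * M) * Real.sinh (√(s ^ 2 + 2) * M)
      - √(s ^ 2 + 2) * Real.cosh (√(s ^ 2 + 2) * M) * Real.sin (s * M))
      (Icc (π / M) (2 * π / M)) := by
    apply Continuous.continuousOn
    fun_prop
  have hs : ∀ s : ℝ, 0 < Real.sinh (√(s ^ 2 + 2) * M) := fun s => by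
    rw [Real.sinh_pos_iff]; positivity
  obtain ⟨s, hs1, hs2⟩ := intermediate_value_Ioo hle hc (show (0 : ℝ) ∈ _ from by
    constructor
    · have h1 : π / M * M = π := by field_simp
      have h2 := hs (π / M)
      have : 0 < π / M * Real.sinh (√((π / M) ^ 2 + 2) * M) := by positivity
      simp only [h1, Real.cos_pi, Real.sin_pi]
      linarith
    · have h1 : 2 * π / M * M = 2 * π := by field_simp
      have h2 := hs (2 * π / M)
      have : 0 < 2 * π / M * Real.sinh (√((2 * π / M) ^ 2 + 2) * M) := by positivity
      simp only [h1, Real.cos_two_pi, Real.sin_two_pi]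
      linarith)
  exact ⟨s, hs1, hs2⟩

theorem clamped_plate_stmt10
    (κ : ℝ) (hκ : 0 < κ) (lamstar : ℝ → ℝ)
    (h : ∀ L : ℝ, 0 < L →
      IsLeast {l : ℝ | κ < l ∧
        2 * Real.sqrt (l ^ 2 / κ ^ 2 - 1) *
            Real.cos (Real.sqrt (l ^ 2 / κ ^ 2 - 1) * (κ * L)) /
            Real.sin (Real.sqrt (l ^ 2 / κ ^ 2 - 1) * (κ * L))
          - 2 * Real.sqrt (l ^ 2 / κ ^ 2 + 1) *
            Real.cosh (Real.sqrt (l ^ 2 / κ ^ 2 + 1) * (κ * L)) /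
            Real.sinh (Real.sqrt (l ^ 2 / κ ^ 2 + 1) * (κ * L)) = 0}
        (lamstar L)) :
    Filter.Tendsto lamstar Filter.atTop (nhds κ) ∧
    Filter.Tendsto (fun L => (lamstar L) ^ 4) Filter.atTop (nhds (κ ^ 4)) := by
  have key : ∀ L : ℝ, 0 < L → lamstar L ≤ κ * √(1 + (2 * π / (κ * L)) ^ 2) := by
    intro L hL
    have hM : 0 < κ * L := by positivity
    obtain ⟨s, ⟨hs1, hs2⟩, hs⟩ := exists_root_aux (κ * L) hM
    have hpi := Real.pi_pos
    have hs0 : 0 < s := lt_trans (by positivity) hs1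
    have hsq : (κ * √(1 + s ^ 2)) ^ 2 / κ ^ 2 = 1 + s ^ 2 := by
      rw [mul_pow, Real.sq_sqrt (by positivity)]; field_simp
    have e1 : √((κ * √(1 + s ^ 2)) ^ 2 / κ ^ 2 - 1) = s := by
      rw [hsq, add_sub_cancel_left, Real.sqrt_sq hs0.le]
    have e2 : √((κ * √(1 + s ^ 2)) ^ 2 / κ ^ 2 + 1) = √(s ^ 2 + 2) := by
      rw [hsq]; congr 1; ring
    have hmem : lamstar L ≤ κ * √(1 + s ^ 2) := by
      apply (h L hL).2
      refine ⟨?_, ?_⟩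
      · have : 1 < √(1 + s ^ 2) := by
          rw [Real.lt_sqrt (by norm_num)]; nlinarith
        nlinarith
      · rw [e1, e2]
        have hsin : Real.sin (s * (κ * L)) ≠ 0 := by
          rw [div_lt_iff₀ hM] at hs1
          rw [lt_div_iff₀ hM] at hs2
          have := Real.sin_pos_of_pos_of_lt_pi (x := s * (κ * L) - π) (by linarith) (by linarith)
          rw [Real.sin_sub_pi] at this
          linarith
        have hsinh : Real.sinh (√(s ^ 2 + 2) * (κ * L)) ≠ 0 := by
          apply ne_of_gt
          rw [Real.sinh_pos_iff]; positivity
        rw [div_sub_div _ _ hsin hsinh, div_eq_zero_iff]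
        left
        linear_combination 2 * hs
    refine hmem.trans ?_
    gcongr
  have hlim : Tendsto (fun L : ℝ => κ * √(1 + (2 * π / (κ * L)) ^ 2)) atTop (nhds κ) := by
    have h1 : Tendsto (fun L : ℝ => 2 * π / (κ * L)) atTop (nhds 0) :=
      Tendsto.const_div_atTop (tendsto_id.const_mul_atTop hκ) _
    have h2 : Continuous (fun x : ℝ => κ * √(1 + x ^ 2)) := by fun_prop
    have h3 := (h2.tendsto 0).comp h1
    simpa [Function.comp_def] using h3
  have main : Tendsto lamstar atTop (nhds κ) := by
    refine tendsto_of_tendsto_of_tendsto_of_le_of_le' tendsto_const_nhds hlim ?_ ?_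
    · filter_upwards [eventually_gt_atTop 0] with L hL using (h L hL).1.1.le
    · filter_upwards [eventually_gt_atTop 0] with L hL using key L hL
  exact ⟨main, main.pow 4⟩
end

section
/- Let κ > 0, and for each L > 0 let λ*(L) be the smallest zero in (κ, ∞) of the function F_L(λ) = 2√(λ²/κ² − 1)·cot(√(λ²/κ² − 1)·κL) − 2√(λ²/κ² + 1)·coth(√(λ²/κ² + 1)·κL). Let 𝔥 be the smallest positive solution of sin(x)·cosh(x) = cos(x)·sinh(x). Then lim_{L→0⁺} L²·(λ*(L)² − κ²) = 𝔥². -/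
open Real Set Filter Topology

lemma cp_sinh_le (y : ℝ) (hy : 0 < y) : Real.sinh y ≤ y * Real.cosh y := by
  have hm : MonotoneOn (fun t : ℝ => t * Real.cosh t - Real.sinh t) (Set.Ici 0) := by
    apply monotoneOn_of_deriv_nonneg (convex_Ici 0)
    · fun_prop
    · fun_prop
    · intro t ht
      rw [interior_Ici] at ht
      have hd : HasDerivAt (fun t : ℝ => t * Real.cosh t - Real.sinh t)
          (1 * Real.cosh t + t * Real.sinh t - Real.cosh t) t :=
        ((hasDerivAt_id t).mul (Real.hasDerivAt_cosh t)).sub (Real.hasDerivAt_sinh t)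
      rw [hd.deriv]
      have h1 : 0 < Real.sinh t := Real.sinh_pos_iff.2 ht
      have h2 : 0 < t * Real.sinh t := mul_pos ht h1
      linarith
  have := hm (Set.mem_Ici.2 le_rfl) (Set.mem_Ici.2 hy.le) hy.le
  simp at this
  exact this

lemma cp_xcos (x : ℝ) (hx : 0 < x) (hx' : x ≤ π) : x * Real.cos x < Real.sin x := by
  rcases lt_or_ge x (π / 2) with h1 | h1
  · have hc : 0 < Real.cos x := Real.cos_pos_of_mem_Ioo ⟨by linarith, h1⟩
    have := Real.lt_tan hx h1
    rw [Real.tan_eq_sin_div_cos, lt_div_iff₀ hc] at this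
    exact this
  · have hc : Real.cos x ≤ 0 := Real.cos_nonpos_of_pi_div_two_le_of_le h1 (by linarith [Real.pi_pos])
    rcases lt_or_eq_of_le hx' with h2 | h2
    · have := Real.sin_pos_of_pos_of_lt_pi hx h2
      nlinarith
    · subst h2
      simp [Real.pi_pos]

/-- the cleared-denominator function -/
noncomputable def cpG (κ x L : ℝ) : ℝ :=
  x * Real.cos x * Real.sinh (Real.sqrt (x ^ 2 + 2 * κ ^ 2 * L ^ 2)) -
    Real.sqrt (x ^ 2 + 2 * κ ^ 2 * L ^ 2) *
      Real.cosh (Real.sqrt (x ^ 2 + 2 * κ ^ 2 * L ^ 2)) * Real.sin x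

lemma cpG_cont (κ : ℝ) : Continuous (fun p : ℝ × ℝ => cpG κ p.1 p.2) := by
  unfold cpG
  fun_prop

lemma cp_neg (x y : ℝ) (hx : 0 < x) (hx' : x ≤ π) (hy : 0 < y) :
    x * Real.cos x * Real.sinh y - y * Real.cosh y * Real.sin x < 0 := by
  have h1 := cp_xcos x hx hx'
  have h2 := cp_sinh_le y hy
  have h3 : 0 < Real.sinh y := Real.sinh_pos_iff.2 hy
  have h4 := Real.sin_nonneg_of_nonneg_of_le_pi hx.le hx'
  nlinarith [mul_pos (sub_pos.2 h1) h3, mul_nonneg (sub_nonneg.2 h2) h4]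

lemma cpG_neg (κ x L : ℝ) (hx : 0 < x) (hx' : x ≤ π) : cpG κ x L < 0 :=
  cp_neg x _ hx hx' (Real.sqrt_pos.2 (by positivity))

lemma cpG_zero (κ x : ℝ) (hx : 0 < x) :
    cpG κ x 0 = x * (Real.cos x * Real.sinh x - Real.sin x * Real.cosh x) := by
  have : Real.sqrt (x ^ 2 + 2 * κ ^ 2 * 0 ^ 2) = x := by
    rw [show x ^ 2 + 2 * κ ^ 2 * 0 ^ 2 = x ^ 2 by ring, Real.sqrt_sq hx.le]
  unfold cpG
  rw [this]
  ring

lemma cp_mono : StrictMonoOn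
    (fun x : ℝ => Real.cos x * Real.sinh x - Real.sin x * Real.cosh x) (Set.Icc π (2 * π)) := by
  apply strictMonoOn_of_deriv_pos (convex_Icc _ _)
  · fun_prop
  · intro t ht
    rw [interior_Icc] at ht
    have hd : HasDerivAt (fun x : ℝ => Real.cos x * Real.sinh x - Real.sin x * Real.cosh x)
        ((-Real.sin t * Real.sinh t + Real.cos t * Real.cosh t) -
          (Real.cos t * Real.cosh t + Real.sin t * Real.sinh t)) t :=
      ((Real.hasDerivAt_cos t).mul (Real.hasDerivAt_sinh t)).sub
        ((Real.hasDerivAt_sin t).mul (Real.hasDerivAt_cosh t))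
    rw [hd.deriv]
    have h1 : 0 < Real.sinh t := Real.sinh_pos_iff.2 (by linarith [ht.1, Real.pi_pos])
    have h2 : Real.sin t < 0 := by
      have := Real.sin_pos_of_pos_of_lt_pi (x := t - π) (by linarith [ht.1]) (by linarith [ht.2])
      rw [Real.sin_sub_pi] at this
      linarith
    nlinarith [mul_pos h1 (neg_pos.2 h2)]

/-- equation versus `cpG` in rescaled variables -/
lemma cp_iff (κ L l : ℝ) (hκ : 0 < κ) (hL : 0 < L) (hl : κ < l) :
    (2 * Real.sqrt (l ^ 2 / κ ^ 2 - 1) *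
            Real.cos (Real.sqrt (l ^ 2 / κ ^ 2 - 1) * (κ * L)) /
            Real.sin (Real.sqrt (l ^ 2 / κ ^ 2 - 1) * (κ * L))
          - 2 * Real.sqrt (l ^ 2 / κ ^ 2 + 1) *
            Real.cosh (Real.sqrt (l ^ 2 / κ ^ 2 + 1) * (κ * L)) /
            Real.sinh (Real.sqrt (l ^ 2 / κ ^ 2 + 1) * (κ * L)) = 0) ↔
      cpG κ (Real.sqrt (l ^ 2 / κ ^ 2 - 1) * (κ * L)) L = 0 := by
  have h0 : 0 < l ^ 2 / κ ^ 2 - 1 := by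
    rw [sub_pos, one_lt_div (by positivity)]
    nlinarith
  have hy : Real.sqrt ((Real.sqrt (l ^ 2 / κ ^ 2 - 1) * (κ * L)) ^ 2 + 2 * κ ^ 2 * L ^ 2) =
      Real.sqrt (l ^ 2 / κ ^ 2 + 1) * (κ * L) := by
    rw [← Real.sqrt_sq (show 0 ≤ Real.sqrt (l ^ 2 / κ ^ 2 + 1) * (κ * L) by positivity)]
    congr 1
    rw [mul_pow, mul_pow (Real.sqrt (l ^ 2 / κ ^ 2 + 1)), Real.sq_sqrt h0.le,
      Real.sq_sqrt (by positivity)]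
    ring
  unfold cpG
  rw [hy]
  have hp := Real.sqrt_pos.2 h0
  have hq : 0 < Real.sqrt (l ^ 2 / κ ^ 2 + 1) := Real.sqrt_pos.2 (by positivity)
  generalize Real.sqrt (l ^ 2 / κ ^ 2 - 1) = p at *
  generalize Real.sqrt (l ^ 2 / κ ^ 2 + 1) = q at *
  have hm : 0 < κ * L := by positivity
  generalize κ * L = m at *
  have hs : 0 < Real.sinh (q * m) := Real.sinh_pos_iff.2 (by positivity)
  have hch : 0 < Real.cosh (q * m) := Real.cosh_pos _
  have hpm : 0 < p * m := by positivity
  have hsc := Real.sin_sq_add_cos_sq (p * m)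
  by_cases hsin : Real.sin (p * m) = 0
  · rw [hsin] at hsc ⊢
    have hc : Real.cos (p * m) ≠ 0 := by
      intro hc
      rw [hc] at hsc
      norm_num at hsc
    constructor
    · intro h
      exfalso
      have : 0 < 2 * q * Real.cosh (q * m) / Real.sinh (q * m) := by positivity
      rw [div_zero] at h
      linarith
    · intro h
      exfalso
      have : p * m * Real.cos (p * m) * Real.sinh (q * m) ≠ 0 :=
        mul_ne_zero (mul_ne_zero hpm.ne' hc) hs.ne'
      apply this
      linarith
  · rw [sub_eq_zero, div_eq_div_iff hsin hs.ne']
    constructor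
    · intro h
      linear_combination (m / 2) * h
    · intro h
      apply mul_left_cancel₀ hm.ne'
      linear_combination 2 * h

theorem clamped_plate_stmt11
    (κ : ℝ) (hκ : 0 < κ) (lamstar : ℝ → ℝ)
    (h : ∀ L : ℝ, 0 < L →
      IsLeast {l : ℝ | κ < l ∧
        2 * Real.sqrt (l ^ 2 / κ ^ 2 - 1) *
            Real.cos (Real.sqrt (l ^ 2 / κ ^ 2 - 1) * (κ * L)) /
            Real.sin (Real.sqrt (l ^ 2 / κ ^ 2 - 1) * (κ * L))
          - 2 * Real.sqrt (l ^ 2 / κ ^ 2 + 1) *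
            Real.cosh (Real.sqrt (l ^ 2 / κ ^ 2 + 1) * (κ * L)) /
            Real.sinh (Real.sqrt (l ^ 2 / κ ^ 2 + 1) * (κ * L)) = 0}
        (lamstar L))
    (𝔥 : ℝ)
    (h𝔥 : IsLeast {x : ℝ | 0 < x ∧
      Real.sin x * Real.cosh x = Real.cos x * Real.sinh x} 𝔥) :
    Filter.Tendsto (fun L => L ^ 2 * ((lamstar L) ^ 2 - κ ^ 2))
      (nhdsWithin 0 (Set.Ioi 0)) (nhds (𝔥 ^ 2)) := by
  have hφ : ∀ x : ℝ, 0 < x → x < 𝔥 → Real.cos x * Real.sinh x - Real.sin x * Real.cosh x ≠ 0 := by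
    intro x hx hx' he
    have := h𝔥.2 (show x ∈ {x : ℝ | 0 < x ∧
      Real.sin x * Real.cosh x = Real.cos x * Real.sinh x} from ⟨hx, by linarith⟩)
    linarith
  have hh0 : Real.cos 𝔥 * Real.sinh 𝔥 - Real.sin 𝔥 * Real.cosh 𝔥 = 0 := by
    linarith [h𝔥.1.2]
  have hhpos : 0 < 𝔥 := h𝔥.1.1
  have hpi := Real.pi_gt_three
  have hhpi : π < 𝔥 := by
    by_contra hc
    have := cp_neg 𝔥 𝔥 hhpos (not_lt.1 hc) hhpos
    have h2 : 𝔥 * Real.cos 𝔥 * Real.sinh 𝔥 - 𝔥 * Real.cosh 𝔥 * Real.sin 𝔥 = 0 := by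
      linear_combination 𝔥 * hh0
    linarith
  have h2pi : 0 < Real.cos (2 * π) * Real.sinh (2 * π) - Real.sin (2 * π) * Real.cosh (2 * π) := by
    have : 0 < Real.sinh (2 * π) := Real.sinh_pos_iff.2 (by positivity)
    simpa using this
  have hh2pi : 𝔥 < 2 * π := by
    by_contra hc
    have hc := not_lt.1 hc
    obtain ⟨z, hz, hz0⟩ := intermediate_value_Ioo (a := π) (b := 2 * π) (by linarith)
      (f := fun x : ℝ => Real.cos x * Real.sinh x - Real.sin x * Real.cosh x) (by fun_prop)
      (show (0 : ℝ) ∈ Set.Ioo _ _ from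
        ⟨by simpa using Real.sinh_pos_iff.2 Real.pi_pos, h2pi⟩)
    exact hφ z (by linarith [hz.1]) (by linarith [hz.2]) hz0
  set X : ℝ → ℝ := fun L => Real.sqrt ((lamstar L) ^ 2 / κ ^ 2 - 1) * (κ * L) with hX
  have hX2 : ∀ L : ℝ, 0 < L → X L ^ 2 = L ^ 2 * ((lamstar L) ^ 2 - κ ^ 2) := by
    intro L hL
    have hl := (h L hL).1.1
    have h0 : 0 ≤ (lamstar L) ^ 2 / κ ^ 2 - 1 := by
      rw [sub_nonneg, one_le_div (by positivity)]
      nlinarith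
    simp only [hX]
    rw [mul_pow, Real.sq_sqrt h0]
    field_simp
  have hXpos : ∀ L : ℝ, 0 < L → 0 < X L := by
    intro L hL
    have hl := (h L hL).1.1
    have h0 : 0 < (lamstar L) ^ 2 / κ ^ 2 - 1 := by
      rw [sub_pos, one_lt_div (by positivity)]
      nlinarith
    have := Real.sqrt_pos.2 h0
    simp only [hX]
    positivity
  have hXroot : ∀ L : ℝ, 0 < L → cpG κ (X L) L = 0 := by
    intro L hL
    exact (cp_iff κ L _ hκ hL (h L hL).1.1).1 (h L hL).1.2
  have hXleast : ∀ L : ℝ, 0 < L → ∀ x : ℝ, 0 < x → cpG κ x L = 0 → X L ≤ x := by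
    intro L hL x hx hg
    have hlpos : κ < Real.sqrt (κ ^ 2 + x ^ 2 / L ^ 2) := by
      apply Real.lt_sqrt_of_sq_lt
      have : 0 < x ^ 2 / L ^ 2 := by positivity
      linarith
    have hsq : Real.sqrt (κ ^ 2 + x ^ 2 / L ^ 2) ^ 2 = κ ^ 2 + x ^ 2 / L ^ 2 :=
      Real.sq_sqrt (by positivity)
    have hx1 : Real.sqrt (Real.sqrt (κ ^ 2 + x ^ 2 / L ^ 2) ^ 2 / κ ^ 2 - 1) * (κ * L) = x := by
      have : Real.sqrt (κ ^ 2 + x ^ 2 / L ^ 2) ^ 2 / κ ^ 2 - 1 = (x / (κ * L)) ^ 2 := by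
        rw [hsq]
        field_simp
        ring
      rw [this, Real.sqrt_sq (by positivity)]
      field_simp
    have hle := (h L hL).2 ⟨hlpos, (cp_iff κ L _ hκ hL hlpos).2 (by rw [hx1]; exact hg)⟩
    have hl := (h L hL).1.1
    have : X L ^ 2 ≤ x ^ 2 := by
      rw [hX2 L hL]
      have h3 : lamstar L ^ 2 ≤ κ ^ 2 + x ^ 2 / L ^ 2 := by
        rw [← hsq]
        exact pow_le_pow_left₀ (by linarith) hle 2
      have h4 : L ^ 2 * (lamstar L ^ 2 - κ ^ 2) ≤ L ^ 2 * (x ^ 2 / L ^ 2) :=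
        mul_le_mul_of_nonneg_left (by linarith) (by positivity)
      have h5 : L ^ 2 * (x ^ 2 / L ^ 2) = x ^ 2 := by field_simp
      linarith
    exact (abs_le_of_sq_le_sq'  this hx.le).2
  have hpos : ∀ᶠ L : ℝ in nhdsWithin 0 (Set.Ioi 0), 0 < L := self_mem_nhdsWithin
  have hXt : Filter.Tendsto X (nhdsWithin 0 (Set.Ioi 0)) (nhds 𝔥) := by
    rw [tendsto_order]
    constructor
    · intro a ha
      have hK : ∀ᶠ L : ℝ in nhds 0, ∀ x ∈ Set.Icc 1 a, cpG κ x L ≠ 0 := by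
        apply isCompact_Icc.eventually_forall_of_forall_eventually
        intro x hx
        have hne : cpG κ x 0 ≠ 0 := by
          rw [cpG_zero κ x (by linarith [hx.1])]
          exact mul_ne_zero (by linarith [hx.1])
            (hφ x (by linarith [hx.1]) (by linarith [hx.2]))
        have hc : Continuous (fun p : ℝ × ℝ => cpG κ p.2 p.1) :=
          (cpG_cont κ).comp continuous_swap
        exact hc.continuousAt.eventually_ne (x := ((0 : ℝ), x)) hne
      filter_upwards [hpos, nhdsWithin_le_nhds hK] with L hL hK
      by_contra hc
      have hc := not_lt.1 hc
      have hr := hXroot L hL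
      rcases le_or_gt (X L) π with h1 | h1
      · have := cpG_neg κ (X L) L (hXpos L hL) h1
        linarith
      · exact hK (X L) ⟨by linarith, hc⟩ hr
    · intro b hb
      set c := min b (2 * π) with hcdef
      have hc1 : 𝔥 < c := lt_min hb hh2pi
      have hc2 : c ≤ 2 * π := min_le_right _ _
      have hφc := cp_mono ⟨hhpi.le, hh2pi.le⟩ ⟨by linarith, hc2⟩ hc1
      simp only [hh0] at hφc
      have hgc : 0 < cpG κ c 0 := by
        rw [cpG_zero κ c (by linarith)]
        exact mul_pos (by linarith) hφc
      have hcont : Continuous (fun L : ℝ => cpG κ c L) :=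
        (cpG_cont κ).comp (Continuous.prodMk_right c)
      have hev : ∀ᶠ L : ℝ in nhds 0, 0 < cpG κ c L :=
        hcont.continuousAt.eventually_const_lt hgc
      filter_upwards [hpos, nhdsWithin_le_nhds hev] with L hL hg
      have hcx : Continuous (fun x : ℝ => cpG κ x L) :=
        (cpG_cont κ).comp (Continuous.prodMk_left L)
      obtain ⟨z, hz, hz0⟩ := intermediate_value_Ioo (a := 1) (b := c) (by linarith)
        hcx.continuousOn (show (0 : ℝ) ∈ Set.Ioo _ _ from
          ⟨cpG_neg κ 1 L one_pos (by linarith), hg⟩)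
      have := hXleast L hL z (by linarith [hz.1]) hz0
      exact lt_of_le_of_lt this (lt_of_lt_of_le hz.2 (min_le_left _ _))
  refine (hXt.pow 2).congr' ?_
  filter_upwards [hpos] with L hL
  exact hX2 L hL
end

section
/- Let 𝔥 be the smallest positive solution of sin(x)·cosh(x) = cos(x)·sinh(x). Then π < 𝔥 < 2^{1/3}·π. -/
open Real

theorem clamped_plate_stmt12
    (𝔥 : ℝ)
    (h𝔥 : IsLeast {x : ℝ | 0 < x ∧
      Real.sin x * Real.cosh x = Real.cos x * Real.sinh x} 𝔥) :
    Real.pi < 𝔥 ∧ 𝔥 < (2 : ℝ) ^ ((1 : ℝ) / 3) * Real.pi := by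
  obtain ⟨⟨hpos, heq⟩, hleast⟩ := h𝔥
  have hpi := Real.pi_pos
  let f : ℝ → ℝ := fun x => Real.sin x * Real.cosh x - Real.cos x * Real.sinh x
  have hd : ∀ x, HasDerivAt f (2 * (Real.sin x * Real.sinh x)) x := by
    intro x
    have h := ((Real.hasDerivAt_sin x).mul (Real.hasDerivAt_cosh x)).sub
      ((Real.hasDerivAt_cos x).mul (Real.hasDerivAt_sinh x))
    refine h.congr_deriv ?_
    ring
  have hc : Continuous f := continuous_iff_continuousAt.2 fun x => (hd x).continuousAt
  have hmono : StrictMonoOn f (Set.Icc 0 Real.pi) := by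
    apply strictMonoOn_of_deriv_pos (convex_Icc _ _) hc.continuousOn
    intro x hx
    rw [interior_Icc] at hx
    rw [(hd x).deriv]
    have h1 := Real.sin_pos_of_pos_of_lt_pi hx.1 hx.2
    have h2 := Real.sinh_pos_iff.2 hx.1
    positivity
  have hf0 : f 0 = 0 := by simp [f]
  have hfh : f 𝔥 = 0 := sub_eq_zero.2 heq
  constructor
  · by_contra! hle
    have h := hmono ⟨le_rfl, hpi.le⟩ ⟨hpos.le, hle⟩ hpos
    linarith
  · have hfpi : 0 < f Real.pi := by
      simp [f, hpi]
    have hf5 : f (Real.pi / 4 + Real.pi) ≤ 0 := by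
      have h1 := Real.sinh_lt_cosh (Real.pi / 4 + Real.pi)
      have h2 : 0 < √2 := by positivity
      simp only [f, Real.sin_add_pi, Real.cos_add_pi, Real.sin_pi_div_four,
        Real.cos_pi_div_four]
      nlinarith
    obtain ⟨c, hc1, hc2⟩ := intermediate_value_Icc' (by linarith : Real.pi ≤ Real.pi / 4 + Real.pi)
      hc.continuousOn ⟨hf5, hfpi.le⟩
    have hle : 𝔥 ≤ c := hleast ⟨by linarith [hc1.1], sub_eq_zero.1 hc2⟩
    have hr : (5 / 4 : ℝ) < (2 : ℝ) ^ ((1 : ℝ) / 3) := by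
      rw [Real.lt_rpow_iff_log_lt (by norm_num) (by norm_num)]
      have h : Real.log ((5 / 4 : ℝ) ^ 3) < Real.log 2 :=
        Real.log_lt_log (by norm_num) (by norm_num)
      rw [Real.log_pow] at h
      push_cast at h
      linarith
    nlinarith [hc1.2]
end

section
/- Let n ≥ 2 be an integer, κ > 0, L ≥ 0, and let g : ℝ → ℝ be Lebesgue-integrable on [0, L]. Define ω_n = π^{n/2}/Γ(n/2 + 1), V_κ(r) = n·ω_n·∫₀^r (sinh(κρ)/κ)^{n−1} dρ, p_κ(x) = 2/(κ(1 − |x|²)) and d_κ(x) = (1/κ)·log((1+|x|)/(1−|x|)) for x in the open unit ball of ℝⁿ, and let r_L ≥ 0 be the unique real number with V_κ(r_L) = L. Then ∫₀^L g(s) ds = ∫_{|x| < tanh(κ·r_L/2)} g(V_κ(d_κ(x)))·p_κ(x)ⁿ dx. -/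
open Real Set MeasureTheory

lemma aux_deriv (m : ℕ) (κ c y : ℝ) (hκ : 0 < κ) (h0 : -1 < y) (h1 : y < 1) :
    HasDerivAt (fun y : ℝ => c * ∫ ρ in (0 : ℝ)..((1 / κ) * Real.log ((1 + y) / (1 - y))),
      (Real.sinh (κ * ρ) / κ) ^ m)
      (c * (y ^ m * (2 / (κ * (1 - y ^ 2))) ^ (m + 1))) y := by
  have hp : 0 < 1 + y := by linarith
  have hq : 0 < 1 - y := by linarith
  have hpq : 1 - y ^ 2 ≠ 0 := by nlinarith [mul_pos hp hq]
  have hcont : Continuous (fun ρ : ℝ => (Real.sinh (κ * ρ) / κ) ^ m) := by fun_prop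
  have hF : ∀ r : ℝ, HasDerivAt (fun r : ℝ => ∫ ρ in (0 : ℝ)..r, (Real.sinh (κ * ρ) / κ) ^ m)
      ((Real.sinh (κ * r) / κ) ^ m) r := fun r =>
    intervalIntegral.integral_hasDerivAt_right (hcont.intervalIntegrable _ _)
      (hcont.stronglyMeasurableAtFilter _ _) hcont.continuousAt
  have hd : HasDerivAt (fun y : ℝ => (1 / κ) * Real.log ((1 + y) / (1 - y)))
      (2 / (κ * (1 - y ^ 2))) y := by
    have h1 : HasDerivAt (fun y : ℝ => 1 + y) 1 y := (hasDerivAt_id y).const_add 1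
    have h2 : HasDerivAt (fun y : ℝ => 1 - y) (-1) y := (hasDerivAt_id y).const_sub 1
    have h3 := ((h1.fun_div h2 hq.ne').log (div_pos hp hq).ne').const_mul (1 / κ)
    refine h3.congr_deriv ?_
    have : 1 - y ^ 2 = (1 + y) * (1 - y) := by ring
    rw [this]
    field_simp
    ring
  have hs : Real.sinh (κ * ((1 / κ) * Real.log ((1 + y) / (1 - y)))) / κ
      = y * (2 / (κ * (1 - y ^ 2))) := by
    have e : κ * ((1 / κ) * Real.log ((1 + y) / (1 - y))) = Real.log ((1 + y) / (1 - y)) := by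
      field_simp
    rw [e, Real.sinh_log (div_pos hp hq)]
    have : 1 - y ^ 2 = (1 + y) * (1 - y) := by ring
    rw [this]
    field_simp
    ring
  have := ((hF _).comp y hd).const_mul c
  refine this.congr_deriv ?_
  rw [hs, mul_pow, pow_succ]
  ring

lemma aux_radial (n : ℕ) (hn : 2 ≤ n) (t : ℝ) (F : ℝ → ℝ) :
    ∫ x in {x : EuclideanSpace ℝ (Fin n) | ‖x‖ < t}, F ‖x‖ =
      ∫ y in Ioo (0 : ℝ) t, (n : ℝ) * (Real.pi ^ ((n : ℝ) / 2) / Real.Gamma ((n : ℝ) / 2 + 1))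
        * (y ^ (n - 1) * F y) := by
  have : Nonempty (Fin n) := ⟨⟨0, by omega⟩⟩
  have hG : 0 < Real.Gamma ((n : ℝ) / 2 + 1) := Real.Gamma_pos_of_pos (by positivity)
  have hm : MeasurableSet {x : EuclideanSpace ℝ (Fin n) | ‖x‖ < t} :=
    measurableSet_lt measurable_norm measurable_const
  have hvol : (volume : Measure (EuclideanSpace ℝ (Fin n))).real (Metric.ball 0 1)
      = Real.pi ^ ((n : ℝ) / 2) / Real.Gamma ((n : ℝ) / 2 + 1) := by
    rw [Measure.real, EuclideanSpace.volume_ball]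
    simp only [ENNReal.ofReal_one, one_pow, one_mul, Fintype.card_fin]
    rw [ENNReal.toReal_ofReal (by positivity)]
    congr 1
    rw [Real.sqrt_eq_rpow, ← Real.rpow_natCast, ← Real.rpow_mul Real.pi_pos.le]
    congr 1
    ring
  rw [← integral_indicator hm]
  have e : ({x : EuclideanSpace ℝ (Fin n) | ‖x‖ < t}.indicator fun x => F ‖x‖)
      = fun x => (Iio t).indicator F ‖x‖ := by
    ext x
    simp [indicator]
  rw [e, integral_fun_norm_addHaar, hvol, integral_const_mul]
  simp only [finrank_euclideanSpace, Fintype.card_fin, nsmul_eq_mul, smul_eq_mul, mul_assoc]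
  congr 2
  have e2 : (fun y : ℝ => y ^ (n - 1) * (Iio t).indicator F y)
      = (Iio t).indicator (fun y => y ^ (n - 1) * F y) := by
    ext y
    simp [indicator]
  rw [e2, setIntegral_indicator measurableSet_Iio, Ioi_inter_Iio]

theorem clamped_plate_stmt13
    (n : ℕ) (hn : 2 ≤ n) (κ L : ℝ) (hκ : 0 < κ) (hL : 0 ≤ L)
    (g : ℝ → ℝ) (hg : MeasureTheory.IntegrableOn g (Set.Icc 0 L))
    (rL : ℝ) (hrL : 0 ≤ rL)
    (hV : (n : ℝ) * (Real.pi ^ ((n : ℝ) / 2) / Real.Gamma ((n : ℝ) / 2 + 1)) *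
      (∫ ρ in (0 : ℝ)..rL, (Real.sinh (κ * ρ) / κ) ^ (n - 1)) = L) :
    (∫ s in (0 : ℝ)..L, g s) =
      ∫ x in {x : EuclideanSpace ℝ (Fin n) | ‖x‖ < Real.tanh (κ * rL / 2)},
        g ((n : ℝ) * (Real.pi ^ ((n : ℝ) / 2) / Real.Gamma ((n : ℝ) / 2 + 1)) *
            (∫ ρ in (0 : ℝ)..((1 / κ) * Real.log ((1 + ‖x‖) / (1 - ‖x‖))),
              (Real.sinh (κ * ρ) / κ) ^ (n - 1)))
          * (2 / (κ * (1 - ‖x‖ ^ 2))) ^ n := by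
  set c : ℝ := (n : ℝ) * (Real.pi ^ ((n : ℝ) / 2) / Real.Gamma ((n : ℝ) / 2 + 1)) with hc
  have hG : 0 < Real.Gamma ((n : ℝ) / 2 + 1) := Real.Gamma_pos_of_pos (by positivity)
  have hn0 : 0 < (n : ℝ) := by exact_mod_cast (by omega : 0 < n)
  have hcpos : 0 < c := by positivity
  set t := Real.tanh (κ * rL / 2) with ht
  have ht1 : t < 1 := Real.tanh_lt_one _
  have ht0 : 0 ≤ t := by
    rw [ht, Real.tanh_eq_sinh_div_cosh]
    exact div_nonneg (Real.sinh_nonneg_iff.2 (by positivity)) (Real.cosh_pos _).le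
  set W : ℝ → ℝ := fun y => c * ∫ ρ in (0 : ℝ)..((1 / κ) * Real.log ((1 + y) / (1 - y))),
      (Real.sinh (κ * ρ) / κ) ^ (n - 1) with hW
  have hn1 : n - 1 + 1 = n := by omega
  have hder : ∀ y, -1 < y → y < 1 →
      HasDerivAt W (c * (y ^ (n - 1) * (2 / (κ * (1 - y ^ 2))) ^ n)) y := by
    intro y h0 h1
    have := aux_deriv (n - 1) κ c y hκ h0 h1
    rwa [hn1] at this
  have hpos : ∀ y, 0 < y → y < 1 → 0 < c * (y ^ (n - 1) * (2 / (κ * (1 - y ^ 2))) ^ n) := by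
    intro y h0 h1
    have : 0 < 1 - y ^ 2 := by nlinarith
    positivity
  have hcont : ContinuousOn W (Icc 0 t) := fun y hy =>
    (hder y (by linarith [hy.1]) (by linarith [hy.2])).continuousAt.continuousWithinAt
  have hmono : StrictMonoOn W (Icc 0 t) := by
    refine strictMonoOn_of_deriv_pos (convex_Icc _ _) hcont fun y hy => ?_
    rw [interior_Icc] at hy
    rw [(hder y (by linarith [hy.1]) (by linarith [hy.2])).deriv]
    exact hpos y hy.1 (by linarith [hy.2])
  have hW0 : W 0 = 0 := by simp [hW]
  have hWt : W t = L := by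
    have h : (1 / κ) * Real.log ((1 + t) / (1 - t)) = rL := by
      have h1 := Real.artanh_eq_half_log (x := t) ⟨by linarith, ht1.le⟩
      rw [ht, Real.artanh_tanh, ← ht] at h1
      have h2 : Real.log ((1 + t) / (1 - t)) = κ * rL := by linarith
      rw [h2]
      field_simp
    rw [hW]
    simp only [h]
    exact hV
  have himg : W '' Ioo 0 t = Ioo 0 L := by
    apply Subset.antisymm
    · rintro _ ⟨y, hy, rfl⟩
      have hy' : y ∈ Icc 0 t := Ioo_subset_Icc_self hy
      constructor
      · rw [← hW0]
        exact hmono ⟨le_rfl, ht0⟩ hy' hy.1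
      · rw [← hWt]
        exact hmono hy' ⟨ht0, le_rfl⟩ hy.2
    · have := intermediate_value_Ioo ht0 hcont
      rwa [hW0, hWt] at this
  have hR := aux_radial n hn t (fun y => g (W y) * (2 / (κ * (1 - y ^ 2))) ^ n)
  rw [← hc] at hR
  refine Eq.trans ?_ hR.symm
  rw [intervalIntegral.integral_of_le hL, integral_Ioc_eq_integral_Ioo, ← himg,
    integral_image_eq_integral_abs_deriv_smul measurableSet_Ioo
      (fun y hy => (hder y (by linarith [hy.1]) (by linarith [hy.2])).hasDerivWithinAt)
      (hmono.injOn.mono Ioo_subset_Icc_self)]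
  refine setIntegral_congr_fun measurableSet_Ioo fun y hy => ?_
  have := hpos y hy.1 (by linarith [hy.2])
  simp only [smul_eq_mul]
  rw [abs_of_pos this]
  ring
end

section
/- Let κ > 0 and λ > 0. On the open unit ball of ℝ³, let d_κ(x) = (1/κ)·log((1+|x|)/(1−|x|)) and define u(x) = sinh(√(λ² + κ²)·d_κ(x))/sinh(κ·d_κ(x)) for 0 < |x| < 1. Then, with p_κ(x) = 2/(κ(1 − |x|²)), one has p_κ(x)^{−3}·div(p_κ·∇u)(x) = λ²·u(x) for all 0 < |x| < 1. -/
open Real Set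

lemma cp_hasFDerivAt_norm (y : EuclideanSpace ℝ (Fin 3)) (hy : 0 < ‖y‖) :
    HasFDerivAt (fun z : EuclideanSpace ℝ (Fin 3) => ‖z‖) ((1 / ‖y‖) • innerSL ℝ y) y := by
  have h := ((hasStrictFDerivAt_norm_sq y).hasFDerivAt).sqrt (by positivity)
  have e : (fun z : EuclideanSpace ℝ (Fin 3) => √(‖z‖ ^ 2)) = fun z => ‖z‖ := by
    funext z; exact Real.sqrt_sq (norm_nonneg z)
  rw [e, Real.sqrt_sq hy.le] at h
  refine HasFDerivAt.congr_fderiv h ?_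
  ext v
  simp
  field_simp

lemma cp_radial (F : ℝ → ℝ) (F' : ℝ) (y : EuclideanSpace ℝ (Fin 3)) (hy : 0 < ‖y‖)
    (hF : HasDerivAt F F' ‖y‖) :
    HasFDerivAt (fun z : EuclideanSpace ℝ (Fin 3) => F ‖z‖) ((F' / ‖y‖) • innerSL ℝ y) y := by
  have h := hF.comp_hasFDerivAt y (cp_hasFDerivAt_norm y hy)
  refine HasFDerivAt.congr_fderiv h ?_
  rw [smul_smul]
  congr 1
  ring

lemma cp_L (r : ℝ) (h0 : 0 < r) (h1 : r < 1) :
    HasDerivAt (fun r : ℝ => Real.log ((1 + r) / (1 - r))) (2 / (1 - r ^ 2)) r := by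
  have hm : 1 - r ≠ 0 := by linarith
  have hp : 1 + r ≠ 0 := by linarith
  have hq : 1 - r ^ 2 ≠ 0 := by nlinarith
  have h := (((hasDerivAt_id r).const_add 1).div ((hasDerivAt_id r).const_sub 1) hm).log
    (div_ne_zero hp hm)
  refine HasDerivAt.congr_deriv h ?_
  simp only [id, Pi.div_apply]
  have : 1 - r ^ 2 = (1 - r) * (1 + r) := by ring
  rw [this]
  field_simp
  ring

lemma cp_sinhL (r : ℝ) (h0 : 0 < r) (h1 : r < 1) :
    Real.sinh (Real.log ((1 + r) / (1 - r))) = 2 * r / (1 - r ^ 2) := by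
  have hm : 0 < 1 - r := by linarith
  have hp : 0 < 1 + r := by linarith
  rw [Real.sinh_log (div_pos hp hm)]
  have : 1 - r ^ 2 = (1 - r) * (1 + r) := by ring
  rw [this]
  field_simp
  ring

lemma cp_S (μ r : ℝ) (h0 : 0 < r) (h1 : r < 1) :
    HasDerivAt (fun r : ℝ => Real.sinh (μ * Real.log ((1 + r) / (1 - r))))
      (Real.cosh (μ * Real.log ((1 + r) / (1 - r))) * (μ * (2 / (1 - r ^ 2)))) r :=
  ((cp_L r h0 h1).const_mul μ).sinh

lemma cp_C (μ r : ℝ) (h0 : 0 < r) (h1 : r < 1) :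
    HasDerivAt (fun r : ℝ => Real.cosh (μ * Real.log ((1 + r) / (1 - r))))
      (Real.sinh (μ * Real.log ((1 + r) / (1 - r))) * (μ * (2 / (1 - r ^ 2)))) r :=
  ((cp_L r h0 h1).const_mul μ).cosh

/-- radial profile of u -/
noncomputable def cpU (μ r : ℝ) : ℝ :=
  Real.sinh (μ * Real.log ((1 + r) / (1 - r))) * ((1 - r ^ 2) / (2 * r))

/-- derivative of the profile -/
noncomputable def cpU' (μ r : ℝ) : ℝ :=
  Real.cosh (μ * Real.log ((1 + r) / (1 - r))) * (μ / r) -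
    Real.sinh (μ * Real.log ((1 + r) / (1 - r))) * ((1 + r ^ 2) / (2 * r ^ 2))

lemma cpU_deriv (μ r : ℝ) (h0 : 0 < r) (h1 : r < 1) :
    HasDerivAt (cpU μ) (cpU' μ r) r := by
  have hq : 1 - r ^ 2 ≠ 0 := by nlinarith
  have hr : r ≠ 0 := h0.ne'
  have h2 : HasDerivAt (fun r : ℝ => (1 - r ^ 2) / (2 * r)) (-((1 + r ^ 2) / (2 * r ^ 2))) r := by
    have := (((hasDerivAt_id r).pow 2).const_sub 1).div ((hasDerivAt_id r).const_mul 2)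
      (by simpa using hr)
    refine HasDerivAt.congr_deriv this ?_
    simp
    field_simp
    ring
  have h := (cp_S μ r h0 h1).mul h2
  refine HasDerivAt.congr_deriv h ?_
  unfold cpU'
  field_simp
  ring

lemma cpU'_deriv (μ r : ℝ) (h0 : 0 < r) (h1 : r < 1) :
    HasDerivAt (cpU' μ)
      (Real.sinh (μ * Real.log ((1 + r) / (1 - r))) * (μ * (2 / (1 - r ^ 2))) * (μ / r)
        - Real.cosh (μ * Real.log ((1 + r) / (1 - r))) * (μ / r ^ 2)
        - Real.cosh (μ * Real.log ((1 + r) / (1 - r))) * (μ * (2 / (1 - r ^ 2)))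
            * ((1 + r ^ 2) / (2 * r ^ 2))
        + Real.sinh (μ * Real.log ((1 + r) / (1 - r))) / r ^ 3) r := by
  have hr : r ≠ 0 := h0.ne'
  have ha : HasDerivAt (fun r : ℝ => μ / r) (-(μ / r ^ 2)) r := by
    have := (hasDerivAt_const r μ).div (hasDerivAt_id r) hr
    refine HasDerivAt.congr_deriv this ?_
    simp
    ring
  have hb : HasDerivAt (fun r : ℝ => (1 + r ^ 2) / (2 * r ^ 2)) (-(1 / r ^ 3)) r := by
    have := (((hasDerivAt_id r).pow 2).const_add 1).div (((hasDerivAt_id r).pow 2).const_mul 2)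
      (by simpa using hr)
    refine HasDerivAt.congr_deriv this ?_
    simp
    field_simp
    ring
  have h := ((cp_C μ r h0 h1).mul ha).sub ((cp_S μ r h0 h1).mul hb)
  refine HasDerivAt.congr_deriv h ?_
  ring

lemma cp_H (κ μ r : ℝ) (hκ : 0 < κ) (h0 : 0 < r) (h1 : r < 1) :
    ∃ H', HasDerivAt (fun r => (2 / (κ * (1 - r ^ 2))) * (cpU' μ r / r)) H' r ∧
      ((2 / (κ * (1 - r ^ 2))) ^ 3)⁻¹ *
        (3 * ((2 / (κ * (1 - r ^ 2))) * (cpU' μ r / r)) + r * H') =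
        ((κ * μ) ^ 2 - κ ^ 2) * cpU μ r := by
  have hq : 1 - r ^ 2 ≠ 0 := by nlinarith
  have hr : r ≠ 0 := h0.ne'
  have hp : HasDerivAt (fun r : ℝ => 2 / (κ * (1 - r ^ 2))) (4 * r / (κ * (1 - r ^ 2) ^ 2)) r := by
    have := (hasDerivAt_const r (2:ℝ)).div ((((hasDerivAt_id r).pow 2).const_sub 1).const_mul κ)
      (mul_ne_zero hκ.ne' hq)
    refine HasDerivAt.congr_deriv this ?_
    simp
    field_simp
    ring
  refine ⟨_, hp.mul ((cpU'_deriv μ r h0 h1).div (hasDerivAt_id r) hr), ?_⟩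
  simp only [id, cpU', cpU, Pi.div_apply]
  generalize Real.sinh (μ * Real.log ((1 + r) / (1 - r))) = S
  generalize Real.cosh (μ * Real.log ((1 + r) / (1 - r))) = C
  field_simp
  ring

theorem clamped_plate_stmt19
    (κ lam : ℝ) (hκ : 0 < κ) (hlam : 0 < lam)
    (u : EuclideanSpace ℝ (Fin 3) → ℝ)
    (hu : ∀ x : EuclideanSpace ℝ (Fin 3), 0 < ‖x‖ → ‖x‖ < 1 →
      u x = Real.sinh (Real.sqrt (lam ^ 2 + κ ^ 2) *
              ((1 / κ) * Real.log ((1 + ‖x‖) / (1 - ‖x‖)))) /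
            Real.sinh (κ * ((1 / κ) * Real.log ((1 + ‖x‖) / (1 - ‖x‖))))) :
    ∀ x : EuclideanSpace ℝ (Fin 3), 0 < ‖x‖ → ‖x‖ < 1 →
      ((2 / (κ * (1 - ‖x‖ ^ 2))) ^ 3)⁻¹ *
        (∑ i : Fin 3, fderiv ℝ
          (fun y : EuclideanSpace ℝ (Fin 3) =>
            (2 / (κ * (1 - ‖y‖ ^ 2))) * gradient u y i)
          x (EuclideanSpace.single i 1))
      = lam ^ 2 * u x := by
  intro x hx0 hx1
  obtain ⟨μ, hμ⟩ : ∃ μ, μ = Real.sqrt (lam ^ 2 + κ ^ 2) / κ := ⟨_, rfl⟩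
  have hopen : IsOpen {y : EuclideanSpace ℝ (Fin 3) | 0 < ‖y‖ ∧ ‖y‖ < 1} :=
    (isOpen_lt continuous_const continuous_norm).inter
      (isOpen_lt continuous_norm continuous_const)
  have hu' : ∀ y : EuclideanSpace ℝ (Fin 3), 0 < ‖y‖ → ‖y‖ < 1 → u y = cpU μ ‖y‖ := by
    intro y h0 h1
    have e1 : κ * ((1 / κ) * Real.log ((1 + ‖y‖) / (1 - ‖y‖))) =
        Real.log ((1 + ‖y‖) / (1 - ‖y‖)) := by field_simp
    have e2 : Real.sqrt (lam ^ 2 + κ ^ 2) * ((1 / κ) * Real.log ((1 + ‖y‖) / (1 - ‖y‖))) =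
        μ * Real.log ((1 + ‖y‖) / (1 - ‖y‖)) := by rw [hμ]; ring
    rw [hu y h0 h1, e1, e2, cp_sinhL _ h0 h1, cpU, div_eq_mul_inv, inv_div]
  have hgrad : ∀ y : EuclideanSpace ℝ (Fin 3), 0 < ‖y‖ → ‖y‖ < 1 →
      gradient u y = (cpU' μ ‖y‖ / ‖y‖) • y := by
    intro y h0 h1
    apply HasGradientAt.gradient
    rw [hasGradientAt_iff_hasFDerivAt]
    have h := cp_radial _ _ y h0 (cpU_deriv μ ‖y‖ h0 h1)
    have hev : u =ᶠ[nhds y] fun z => cpU μ ‖z‖ := by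
      filter_upwards [hopen.mem_nhds ⟨h0, h1⟩] with z hz using hu' z hz.1 hz.2
    refine HasFDerivAt.congr_fderiv (h.congr_of_eventuallyEq hev) ?_
    ext v
    simp [inner_smul_left]
  obtain ⟨H', hH, hfin⟩ := cp_H κ μ ‖x‖ hκ hx0 hx1
  have hrad := cp_radial _ _ x hx0 hH
  have key : ∀ i : Fin 3, fderiv ℝ
          (fun y : EuclideanSpace ℝ (Fin 3) =>
            (2 / (κ * (1 - ‖y‖ ^ 2))) * gradient u y i)
          x (EuclideanSpace.single i 1) =
        (2 / (κ * (1 - ‖x‖ ^ 2))) * (cpU' μ ‖x‖ / ‖x‖) + H' / ‖x‖ * (x i) ^ 2 := by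
    intro i
    have hev : (fun y : EuclideanSpace ℝ (Fin 3) =>
            (2 / (κ * (1 - ‖y‖ ^ 2))) * gradient u y i) =ᶠ[nhds x]
          fun y => ((2 / (κ * (1 - ‖y‖ ^ 2))) * (cpU' μ ‖y‖ / ‖y‖)) *
            (EuclideanSpace.proj i : EuclideanSpace ℝ (Fin 3) →L[ℝ] ℝ) y := by
      filter_upwards [hopen.mem_nhds ⟨hx0, hx1⟩] with z hz
      rw [hgrad z hz.1 hz.2]
      simp
      ring
    have hm := hrad.mul (EuclideanSpace.proj i :
      EuclideanSpace ℝ (Fin 3) →L[ℝ] ℝ).hasFDerivAt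
    rw [hev.fderiv_eq]
    refine (congrArg (fun T => T (EuclideanSpace.single i 1)) (HasFDerivAt.fderiv hm)).trans ?_
    simp [EuclideanSpace.inner_single_right]
    ring
  have hn : (x 0) ^ 2 + (x 1) ^ 2 + (x 2) ^ 2 = ‖x‖ ^ 2 := by
    rw [EuclideanSpace.norm_sq_eq, Fin.sum_univ_three]
    simp
  have hlam2 : lam ^ 2 = (κ * μ) ^ 2 - κ ^ 2 := by
    have : κ * μ = Real.sqrt (lam ^ 2 + κ ^ 2) := by rw [hμ]; field_simp
    rw [this, Real.sq_sqrt (by positivity)]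
    ring
  rw [hu' x hx0 hx1, hlam2, ← hfin]
  simp only [key, Fin.sum_univ_three]
  congr 1
  have : H' / ‖x‖ * (x 0 ^ 2 + x 1 ^ 2 + x 2 ^ 2) = ‖x‖ * H' := by
    rw [hn]; field_simp
  linear_combination this
end
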